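/- Let O_{−15} = ℤ[(1+√−15)/2] be the ring of integers of ℚ(√−15), in which 2 splits as 2O_{−15} = p₁p₂ with p₁ ≠ p₂ prime and 3 ramifies as 3O_{−15} = q². Let S be any nonempty finite set of nonzero prime ideals of O_{−15}, and set β_{p_i} = 0 if p_i ∈ S and 1 otherwise (i = 1,2), and β_q = 0 if q ∈ S and 1 otherwise. Then SL₂(O_{−15,S})^ab ≅ (ℤ/4)^{β_{p₁}+β_{p₂}} ⊕ (ℤ/3)^{β_q}. -/

import Mathlib

open IsDedekindDomain NumberField

/-- The abelianization of `SL₂(R)`, written additively. -/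
abbrev SL2ab (R : Type*) [CommRing R] : Type _ :=
  Additive (Abelianization (Matrix.SpecialLinearGroup (Fin 2) R))

/-- `β_x = 0` if `x ∈ S` and `β_x = 1` otherwise. -/
noncomputable def beta {X : Type*} (S : Finset X) (x : X) : ℕ := by
  classical exact if x ∈ S then 0 else 1

section Elementary

variable {A : Type*} [CommRing A]

/-- The upper elementary matrix with off-diagonal entry `x`. -/
def e12 (x : A) : Matrix.SpecialLinearGroup (Fin 2) A := ⟨!![1, x; 0, 1], by simp⟩

/-- The lower elementary matrix with off-diagonal entry `x`. -/
def e21 (x : A) : Matrix.SpecialLinearGroup (Fin 2) A := ⟨!![1, 0; x, 1], by simp⟩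

/-- An element of `SL₂(A)` given by its four entries. -/
def mkSL (a b c d : A) (h : a * d - b * c = 1) : Matrix.SpecialLinearGroup (Fin 2) A :=
  ⟨!![a, b; c, d], by rw [Matrix.det_fin_two_of, h]⟩

variable (A) in
/-- The subgroup of `SL₂(A)` generated by elementary matrices. -/
def elemSubgroup : Subgroup (Matrix.SpecialLinearGroup (Fin 2) A) :=
  Subgroup.closure (Set.range e12 ∪ Set.range e21)

lemma e12_mem (x : A) : e12 x ∈ elemSubgroup A := Subgroup.subset_closure (.inl ⟨x, rfl⟩)

lemma e21_mem (x : A) : e21 x ∈ elemSubgroup A := Subgroup.subset_closure (.inr ⟨x, rfl⟩)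

lemma sl_ext {g h : Matrix.SpecialLinearGroup (Fin 2) A} (h00 : g 0 0 = h 0 0) (h01 : g 0 1 = h 0 1)
    (h10 : g 1 0 = h 1 0) (h11 : g 1 1 = h 1 1) : g = h := by
  ext i j; fin_cases i <;> fin_cases j <;> assumption

lemma sl_det (g : Matrix.SpecialLinearGroup (Fin 2) A) : g 0 0 * g 1 1 - g 0 1 * g 1 0 = 1 := by
  exact (Matrix.det_fin_two g.1).symm.trans g.2

@[simp] lemma e12_00 (x : A) : e12 x 0 0 = 1 := rfl
@[simp] lemma e12_01 (x : A) : e12 x 0 1 = x := rfl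
@[simp] lemma e12_10 (x : A) : e12 x 1 0 = 0 := rfl
@[simp] lemma e12_11 (x : A) : e12 x 1 1 = 1 := rfl
@[simp] lemma e21_00 (x : A) : e21 x 0 0 = 1 := rfl
@[simp] lemma e21_01 (x : A) : e21 x 0 1 = 0 := rfl
@[simp] lemma e21_10 (x : A) : e21 x 1 0 = x := rfl
@[simp] lemma e21_11 (x : A) : e21 x 1 1 = 1 := rfl
@[simp] lemma mkSL_00 (a b c d : A) (h) : mkSL a b c d h 0 0 = a := rfl
@[simp] lemma mkSL_01 (a b c d : A) (h) : mkSL a b c d h 0 1 = b := rfl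
@[simp] lemma mkSL_10 (a b c d : A) (h) : mkSL a b c d h 1 0 = c := rfl
@[simp] lemma mkSL_11 (a b c d : A) (h) : mkSL a b c d h 1 1 = d := rfl

lemma sl_mul (g h : Matrix.SpecialLinearGroup (Fin 2) A) (i j : Fin 2) :
    (g * h) i j = g i 0 * h 0 j + g i 1 * h 1 j := by
  exact (congrFun₂ (Matrix.SpecialLinearGroup.coe_mul g h) i j).trans
    ((Matrix.mul_apply ..).trans (Fin.sum_univ_two _))

lemma e12_add (x y : A) : e12 (x + y) = e12 x * e12 y := by
  apply sl_ext <;> simp [sl_mul, add_comm]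

/-- The row `(c, d)` is the bottom row of a product of elementary matrices. -/
def Good (c d : A) : Prop := ∃ g ∈ elemSubgroup A, g 1 0 = c ∧ g 1 1 = d

lemma Good.mem {g : Matrix.SpecialLinearGroup (Fin 2) A} (h : Good (g 1 0) (g 1 1)) :
    g ∈ elemSubgroup A := by
  obtain ⟨k, hk, h0, h1⟩ := h
  have e : g = e12 (k 0 0 * g 0 1 - g 0 0 * k 0 1) * k := by
    have dg := sl_det g
    have dk := sl_det k
    rw [h0, h1] at dk
    apply sl_ext <;> simp only [sl_mul, e12_00, e12_01, e12_10, e12_11, h0, h1]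
    · linear_combination g 0 0 * (-dk) + k 0 0 * dg
    · linear_combination g 0 1 * (-dk) + k 0 1 * dg
    · ring
    · ring
  rw [e]
  exact mul_mem (e12_mem _) hk

lemma good_of_mem {g : Matrix.SpecialLinearGroup (Fin 2) A} (h : g ∈ elemSubgroup A) :
    Good (g 1 0) (g 1 1) := ⟨g, h, rfl, rfl⟩

lemma Good.mul_right {c d : A} (h : Good c d) {k : Matrix.SpecialLinearGroup (Fin 2) A}
    (hk : k ∈ elemSubgroup A) : Good (c * k 0 0 + d * k 1 0) (c * k 0 1 + d * k 1 1) := by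
  obtain ⟨g, hg, rfl, rfl⟩ := h
  exact ⟨g * k, mul_mem hg hk, sl_mul _ _ _ _, sl_mul _ _ _ _⟩

lemma Good.add_left {c d : A} (h : Good c d) (k : A) : Good (c + k * d) d := by
  simpa [mul_comm] using h.mul_right (e21_mem k)

lemma Good.add_right {c d : A} (h : Good c d) (k : A) : Good c (d + k * c) := by
  simpa [mul_comm, add_comm] using h.mul_right (e12_mem k)

lemma Good.of_add_left {c d : A} (k : A) (h : Good (c + k * d) d) : Good c d := by
  simpa using h.add_left (-k)

lemma Good.of_add_right {c d : A} (k : A) (h : Good c (d + k * c)) : Good c d := by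
  simpa using h.add_right (-k)

lemma Good.rotate {c d : A} (h : Good c d) : Good (-d) c := by
  have := ((h.add_left (-1)).add_right 1).add_left (-1)
  convert this using 1 <;> ring

lemma Good.neg {c d : A} (h : Good c d) : Good (-c) (-d) := h.rotate.rotate

lemma Good.swap_neg {c d : A} (h : Good c d) : Good d (-c) := by
  simpa using h.rotate.neg

lemma good_unit_left {u : A} (hu : IsUnit u) (d : A) : Good u d := by
  obtain ⟨v, hv⟩ := hu.exists_left_inv
  have h0 : Good (0 : A) 1 := ⟨1, one_mem _, rfl, rfl⟩
  have := (h0.add_left u).add_right (v * (d - 1))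
  convert this using 1
  · ring
  · linear_combination (1 - d) * hv

lemma good_unit_right {u : A} (hu : IsUnit u) (d : A) : Good d u := by
  simpa using (good_unit_left hu (-d)).rotate

/-- Conjugation by `diag(u⁻¹, 1)`. -/
def diagConj (u : Aˣ) :
    Matrix.SpecialLinearGroup (Fin 2) A →* Matrix.SpecialLinearGroup (Fin 2) A where
  toFun g := mkSL (g 0 0) (↑u⁻¹ * g 0 1) (u * g 1 0) (g 1 1) (by
    linear_combination sl_det g - g 0 1 * g 1 0 * u.inv_mul)
  map_one' := by apply sl_ext <;> simp
  map_mul' g h := by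
    have := u.inv_mul
    apply sl_ext <;> simp only [sl_mul, mkSL_00, mkSL_01, mkSL_10, mkSL_11]
    · linear_combination -(g 0 1 * h 1 0) * u.inv_mul
    · ring
    · ring
    · linear_combination -(g 1 0 * h 0 1) * u.inv_mul

lemma diagConj_mem (u : Aˣ) {g : Matrix.SpecialLinearGroup (Fin 2) A} (hg : g ∈ elemSubgroup A) :
    diagConj u g ∈ elemSubgroup A := by
  induction hg using Subgroup.closure_induction with
  | mem x hx =>
    obtain ⟨x, rfl⟩ | ⟨x, rfl⟩ := hx
    · have : diagConj u (e12 x) = e12 (↑u⁻¹ * x) := by apply sl_ext <;> simp [diagConj]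
      rw [this]; exact e12_mem _
    · have : diagConj u (e21 x) = e21 (u * x) := by apply sl_ext <;> simp [diagConj]
      rw [this]; exact e21_mem _
  | one => rw [map_one]; exact one_mem _
  | mul x y _ _ hx hy => rw [map_mul]; exact mul_mem hx hy
  | inv x _ hx => rw [map_inv]; exact inv_mem hx

lemma Good.unit_mul_left {u : A} (hu : IsUnit u) {c d : A} (h : Good c d) : Good (u * c) d := by
  obtain ⟨u, rfl⟩ := hu
  obtain ⟨g, hg, rfl, rfl⟩ := h
  exact ⟨_, diagConj_mem u hg, rfl, rfl⟩

lemma Good.unit_mul_right {u : A} (hu : IsUnit u) {c d : A} (h : Good c d) :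
    Good c (u * d) := by
  simpa using (h.swap_neg.unit_mul_left hu).rotate

lemma Good.of_unit_mul_left {u : A} (hu : IsUnit u) {c d : A} (h : Good (u * c) d) :
    Good c d := by
  obtain ⟨u, rfl⟩ := hu
  simpa using h.unit_mul_left (u⁻¹).isUnit

lemma Good.of_unit_mul_right {u : A} (hu : IsUnit u) {c d : A} (h : Good c (u * d)) :
    Good c d := by
  obtain ⟨u, rfl⟩ := hu
  simpa using h.unit_mul_right (u⁻¹).isUnit

lemma transpose_mem {g : Matrix.SpecialLinearGroup (Fin 2) A} (hg : g ∈ elemSubgroup A) :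
    g.transpose ∈ elemSubgroup A := by
  induction hg using Subgroup.closure_induction with
  | mem x hx =>
    obtain ⟨x, rfl⟩ | ⟨x, rfl⟩ := hx
    · have : (e12 x).transpose = e21 x := by apply sl_ext <;> rfl
      rw [this]; exact e21_mem _
    · have : (e21 x).transpose = e12 x := by apply sl_ext <;> rfl
      rw [this]; exact e12_mem _
  | one =>
    have : (1 : Matrix.SpecialLinearGroup (Fin 2) A).transpose = 1 := by
      apply Subtype.ext; simp [Matrix.SpecialLinearGroup.coe_transpose]
    rw [this]; exact one_mem _
  | mul x y _ _ hx hy =>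
    have : (x * y).transpose = y.transpose * x.transpose := by
      apply Subtype.ext; simp [Matrix.SpecialLinearGroup.coe_transpose]
    rw [this]; exact mul_mem hy hx
  | inv x _ hx =>
    have : x⁻¹.transpose = (x.transpose)⁻¹ := by
      apply Subtype.ext; simp [Matrix.SpecialLinearGroup.coe_transpose, Matrix.adjugate_transpose]
    rw [this]; exact inv_mem hx

lemma Good.transpose {a b c d : A} (h : a * d - b * c = 1) (hg : Good c d) : Good b d := by
  have : mkSL a b c d h ∈ elemSubgroup A := Good.mem hg
  exact good_of_mem (transpose_mem this)

end Elementary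

/-- The order `ℤ[ω]` with `ω² = ω - 4`, a model of the ring of integers of `ℚ(√-15)`. -/
abbrev QO : Type := QuadraticAlgebra ℤ (-4) 1

namespace QO

/-- The generator `ω = (1 + √-15) / 2`. -/
def w : QO := ⟨0, 1⟩

@[simp] lemma re_w : w.re = 0 := rfl
@[simp] lemma im_w : w.im = 1 := rfl

/-- The conjugate of `ω`. -/
def w' : QO := ⟨1, -1⟩

@[simp] lemma re_w' : w'.re = 1 := rfl
@[simp] lemma im_w' : w'.im = -1 := rfl

/-- The square root of `-15`. -/
def s : QO := ⟨-1, 2⟩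

@[simp] lemma re_s : s.re = -1 := rfl
@[simp] lemma im_s : s.im = 2 := rfl

/-- The norm form. -/
abbrev nm (x : QO) : ℤ := QuadraticAlgebra.norm x

@[simp] lemma re_ofNat (n : ℕ) [n.AtLeastTwo] : (ofNat(n) : QO).re = ofNat(n) := rfl
@[simp] lemma im_ofNat (n : ℕ) [n.AtLeastTwo] : (ofNat(n) : QO).im = 0 := rfl
@[simp] lemma re_one : (1 : QO).re = 1 := rfl
@[simp] lemma im_one : (1 : QO).im = 0 := rfl

lemma nm_def (x : QO) : nm x = x.re ^ 2 + x.re * x.im + 4 * x.im ^ 2 := by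
  rw [nm, QuadraticAlgebra.norm_def]; ring

lemma four_nm (x : QO) : 4 * nm x = (2 * x.re + x.im) ^ 2 + 15 * x.im ^ 2 := by
  rw [nm_def]; ring

lemma nm_nonneg (x : QO) : 0 ≤ nm x := by
  have := four_nm x
  nlinarith [sq_nonneg (2 * x.re + x.im), sq_nonneg x.im]

lemma nm_pos {x : QO} (hx : x ≠ 0) : 0 < nm x := by
  refine lt_of_le_of_ne (nm_nonneg x) fun h => hx ?_
  have h4 := four_nm x
  rw [← h] at h4
  have h1 : x.im = 0 := by nlinarith [sq_nonneg (2 * x.re + x.im), sq_nonneg x.im]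
  have h2 : x.re = 0 := by rw [h1] at h4; nlinarith [sq_nonneg x.re]
  exact QuadraticAlgebra.ext h2 h1

lemma nm_ne_two (x : QO) : nm x ≠ 2 := by
  intro h
  have h4 := four_nm x
  rw [h] at h4
  have h1 : x.im = 0 := by nlinarith [sq_nonneg (2 * x.re + x.im), sq_nonneg x.im]
  rw [h1] at h4
  have : x.re ^ 2 = 2 := by linarith
  have h5 : x.re ≤ 1 := by nlinarith
  have h6 : -1 ≤ x.re := by nlinarith
  interval_cases x.re <;> omega

instance : IsDomain QO := by
  have : NoZeroDivisors QO := ⟨fun {a b} h => by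
    by_contra! hab
    have := mul_pos (nm_pos hab.1) (nm_pos hab.2)
    rw [← map_mul, h] at this
    simp at this⟩
  exact NoZeroDivisors.to_isDomain _

lemma nm_mul (x y : QO) : nm (x * y) = nm x * nm y := map_mul _ _ _

lemma self_mul_star (x : QO) : x * star x = ((nm x : ℤ) : QO) := by
  rw [← QuadraticAlgebra.algebraMap_norm_eq_mul_star]; rfl

lemma eq_add (x : QO) : x = (x.re : QO) + x.im * w := by
  ext <;> simp

/-- Reduction of lattice points for the Euclidean-type descent. -/
lemma reduce_aux {n X y : ℤ} (hn : 0 < n) (hX0 : 0 ≤ X) (hX : X ≤ n) (hy0 : 0 ≤ y)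
    (hy : 2 * y ≤ n) (h : 4 * n ^ 2 ≤ X ^ 2 + 15 * y ^ 2)
    (hne : ¬ (2 * X = n ∧ 2 * y = n)) :
    X ^ 2 + 15 * y ^ 2 + 4 * n ^ 2 < 2 * X * n + 14 * y * n := by
  have hXn : n ≤ 2 * X := by nlinarith
  obtain ⟨g, hg⟩ : ∃ g, g = 2 * X - n := ⟨_, rfl⟩
  obtain ⟨e, he⟩ : ∃ e, e = n - 2 * y := ⟨_, rfl⟩
  have hg0 : 0 ≤ g := by omega
  have he0 : 0 ≤ e := by omega
  have hgn : g ≤ n := by omega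
  have hen : e ≤ n := by omega
  have h1 : 15 * (e * (2 * n - e)) ≤ g * (2 * n + g) := by
    subst hg he; nlinarith
  have h2 : 5 * e ≤ g := by
    have a1 : e * n ≤ e * (2 * n - e) := by nlinarith
    have a2 : g * (2 * n + g) ≤ g * (3 * n) := by nlinarith
    have a3 : 15 * (e * n) ≤ g * (3 * n) := by nlinarith
    have a4 : 5 * e * n ≤ g * n := by nlinarith
    exact le_of_mul_le_mul_right a4 hn
  have hgpos : 0 < g := by
    rcases hg0.lt_or_eq with h' | h'
    · exact h'
    · exfalso; apply hne; constructor <;> omega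
  have h3 : g ^ 2 - 2 * g * n - 2 * e * n + 15 * e ^ 2 < 0 := by nlinarith [mul_pos hgpos hn]
  subst hg he
  nlinarith

lemma exists_reduce (n : ℤ) (hn : 0 < n) (v : QO) : ∃ k : QO,
    2 * (v - n * k).im ≤ n ∧ -n ≤ 2 * (v - n * k).im ∧
    2 * (v - n * k).re + (v - n * k).im ≤ n ∧ -n ≤ 2 * (v - n * k).re + (v - n * k).im := by
  obtain ⟨k1, h1, h1'⟩ : ∃ k : ℤ, 2 * (v.im - n * k) ≤ n ∧ -n ≤ 2 * (v.im - n * k) := by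
    refine ⟨(2 * v.im + n) / (2 * n), ?_, ?_⟩
    · have := Int.emod_add_mul_ediv (2 * v.im + n) (2 * n)
      have := Int.emod_lt_of_pos (2 * v.im + n) (show 0 < 2 * n by omega)
      linarith
    · have := Int.emod_add_mul_ediv (2 * v.im + n) (2 * n)
      have := Int.emod_nonneg (2 * v.im + n) (show 2 * n ≠ 0 by omega)
      linarith
  obtain ⟨k0, h0, h0'⟩ : ∃ k : ℤ, 2 * (v.re - n * k) + (v.im - n * k1) ≤ n ∧
      -n ≤ 2 * (v.re - n * k) + (v.im - n * k1) := by
    set m := 2 * v.re + (v.im - n * k1)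
    refine ⟨(m + n) / (2 * n), ?_, ?_⟩
    · have := Int.emod_add_mul_ediv (m + n) (2 * n)
      have := Int.emod_lt_of_pos (m + n) (show 0 < 2 * n by omega)
      linarith
    · have := Int.emod_add_mul_ediv (m + n) (2 * n)
      have := Int.emod_nonneg (m + n) (show 2 * n ≠ 0 by omega)
      linarith
  refine ⟨⟨k0, k1⟩, ?_, ?_, ?_, ?_⟩ <;> simp <;> linarith

/-- The descent step: modulo `c`, the entry `d` can be chosen so that one of three moves
lowers the norm of `c`. -/
lemma exists_descent {c d : QO} (hc : c ≠ 0) (hcd : IsCoprime c d) : ∃ k : QO,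
    nm (d - k * c) < nm c ∨ nm (4 * c + s * (d - k * c)) < nm c ∨
      nm (4 * c - s * (d - k * c)) < nm c := by
  have hn := nm_pos hc
  set n := nm c with hndef
  obtain ⟨k, h1, h2, h3, h4⟩ := exists_reduce n hn (d * star c)
  have key : ∀ r : QO, nm (d - (k + r) * c) * n = nm (d * star c - n * k - n * r) := by
    intro r
    have : d * star c - n * k - n * r = (d - (k + r) * c) * star c := by
      rw [hndef, ← self_mul_star]; ring
    rw [this, nm_mul]; congr 1; exact (QuadraticAlgebra.norm_star c).symm
  have key2 : ∀ r : QO, nm (4 * c + s * (d - (k + r) * c)) * n =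
      nm (4 * n + s * (d * star c - n * k - n * r)) := by
    intro r
    have : 4 * n + s * (d * star c - n * k - n * r) =
        (4 * c + s * (d - (k + r) * c)) * star c := by
      rw [hndef, ← self_mul_star]; ring
    rw [this, nm_mul]; congr 1; exact (QuadraticAlgebra.norm_star c).symm
  have key3 : ∀ r : QO, nm (4 * c - s * (d - (k + r) * c)) * n =
      nm (4 * n - s * (d * star c - n * k - n * r)) := by
    intro r
    have : 4 * n - s * (d * star c - n * k - n * r) =
        (4 * c - s * (d - (k + r) * c)) * star c := by
      rw [hndef, ← self_mul_star]; ring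
    rw [this, nm_mul]; congr 1; exact (QuadraticAlgebra.norm_star c).symm
  obtain ⟨v, hv⟩ : ∃ v, v = d * star c - n * k := ⟨_, rfl⟩
  rw [← hv] at h1 h2 h3 h4
  simp only [← hv] at key key2 key3
  have fin : ∀ z : ℤ, z * n < n * n → z < n := fun z h => lt_of_mul_lt_mul_right h hn.le
  by_cases hN : nm v < n * n
  · refine ⟨k, .inl (fin _ ?_)⟩
    have := key 0
    simp only [add_zero, mul_zero, sub_zero] at this
    rwa [this]
  have hN4 : 4 * n ^ 2 ≤ (2 * v.re + v.im) ^ 2 + 15 * v.im ^ 2 := by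
    rw [← four_nm]; nlinarith
  have exc : ¬ (2 * |2 * v.re + v.im| = n ∧ 2 * |v.im| = n) := by
    rintro ⟨e1, e2⟩
    have hd : IsCoprime c (d - k * c) := by
      rw [show d - k * c = d + c * -k by ring]
      exact hcd.add_mul_left_right (-k)
    obtain ⟨p, r, hpr⟩ := hd
    set d' := d - k * c
    have hvd : v = d' * star c := by
      rw [hv, hndef, ← self_mul_star]; ring
    have hsc : star c ≠ 0 := by
      intro h; apply hc; rw [← star_star c, h, star_zero]
    obtain ⟨z, hz, hdz⟩ : ∃ z : QO, (z = w ∨ z = -w ∨ z = w' ∨ z = -w') ∧ 2 * d' = z * c := by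
      have hh : ∀ z : QO, 2 * v = z * n → 2 * d' = z * c := by
        intro z hz
        apply mul_right_cancel₀ hsc
        rw [mul_assoc, ← hvd, hz, hndef, ← self_mul_star, mul_assoc]
      rcases abs_cases (2 * v.re + v.im) with ⟨a1, _⟩ | ⟨a1, _⟩ <;>
      rcases abs_cases v.im with ⟨a2, _⟩ | ⟨a2, _⟩
      · refine ⟨w, by simp, hh _ ?_⟩
        ext <;> simp <;> omega
      · refine ⟨w', by simp, hh _ ?_⟩
        ext <;> simp <;> omega
      · refine ⟨-w', by simp, hh _ ?_⟩
        ext <;> simp <;> omega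
      · refine ⟨-w, by simp, hh _ ?_⟩
        ext <;> simp <;> omega
    have hzz : z * star z = 4 := by
      rcases hz with rfl | rfl | rfl | rfl <;> ext <;> simp
    have c1 : c * (2 * p + z * r) = 2 := by
      linear_combination 2 * hpr - r * hdz
    have c2 : c * (star z * p + 2 * r) = star z := by
      have : star z * d' = 2 * c := by
        have h2 : (2 : QO) ≠ 0 := two_ne_zero
        apply mul_left_cancel₀ h2
        linear_combination star z * hdz + c * hzz
      linear_combination star z * hpr - r * this
    obtain ⟨h, hh⟩ : ∃ h, h = 2 * p + z * r := ⟨_, rfl⟩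
    obtain ⟨g, hg⟩ : ∃ g, g = star z * p + 2 * r := ⟨_, rfl⟩
    rw [← hh] at c1
    rw [← hg] at c2
    have c3 : 2 * g = h * star z := by
      apply mul_left_cancel₀ hc
      linear_combination 2 * c2 - star z * c1
    have evc : (nm c) % 2 = 0 := by
      have i0 := congrArg QuadraticAlgebra.re hdz
      have i1 := congrArg QuadraticAlgebra.im hdz
      have i2 := congrArg QuadraticAlgebra.re c1
      have i3 := congrArg QuadraticAlgebra.im c1
      rw [nm_def]
      have : (c.re + c.im) % 2 = 0 ∨ c.re % 2 = 0 := by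
        rcases hz with rfl | rfl | rfl | rfl <;> simp at i0 i1 <;> omega
      rcases this with h' | h'
      · obtain ⟨m, hm⟩ : ∃ m, c.re = 2 * m - c.im := ⟨(c.re + c.im) / 2, by omega⟩
        rw [hm]; ring_nf; omega
      · obtain ⟨m, hm⟩ : ∃ m, c.re = 2 * m := ⟨c.re / 2, by omega⟩
        rw [hm]; ring_nf; omega
    have evh : (nm h) % 2 = 0 := by
      have i0 := congrArg QuadraticAlgebra.re c3
      have i1 := congrArg QuadraticAlgebra.im c3
      rw [nm_def]
      have : (h.re + h.im) % 2 = 0 ∨ h.re % 2 = 0 := by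
        rcases hz with rfl | rfl | rfl | rfl <;> simp at i0 i1 <;> omega
      rcases this with h' | h'
      · obtain ⟨m, hm⟩ : ∃ m, h.re = 2 * m - h.im := ⟨(h.re + h.im) / 2, by omega⟩
        rw [hm]; ring_nf; omega
      · obtain ⟨m, hm⟩ : ∃ m, h.re = 2 * m := ⟨h.re / 2, by omega⟩
        rw [hm]; ring_nf; omega
    have hp4 : nm c * nm h = 4 := by
      rw [← nm_mul, c1]; simp [nm_def]
    obtain ⟨a, ha⟩ : ∃ a, nm c = 2 * a := ⟨nm c / 2, by omega⟩
    obtain ⟨b, hb⟩ : ∃ b, nm h = 2 * b := ⟨nm h / 2, by omega⟩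
    have hab : a * b = 1 := by rw [ha, hb] at hp4; linarith
    have ha1 : a = 1 := by
      rcases Int.eq_one_or_neg_one_of_mul_eq_one hab with h | h
      · exact h
      · have := nm_nonneg c; omega
    exact nm_ne_two c (by omega)
  have main := reduce_aux hn (abs_nonneg (2 * v.re + v.im)) (abs_le.2 ⟨h4, h3⟩)
    (abs_nonneg v.im) (by rcases abs_cases v.im with ⟨a, _⟩ | ⟨a, _⟩ <;> omega)
    (by simpa only [sq_abs] using hN4) exc
  rw [sq_abs, sq_abs] at main
  rcases abs_cases (2 * v.re + v.im) with ⟨a1, _⟩ | ⟨a1, _⟩ <;>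
  rcases abs_cases v.im with ⟨a2, _⟩ | ⟨a2, _⟩ <;> rw [a1, a2] at main
  · refine ⟨k + w, .inr (.inr (fin _ ?_))⟩
    rw [key3 w, nm_def]; simp; nlinarith
  · refine ⟨k + w', .inr (.inl (fin _ ?_))⟩
    rw [key2 w', nm_def]; simp; nlinarith
  · refine ⟨k + -w', .inr (.inr (fin _ ?_))⟩
    rw [key3 (-w'), nm_def]; simp; nlinarith
  · refine ⟨k + -w, .inr (.inl (fin _ ?_))⟩
    rw [key2 (-w), nm_def]; simp; nlinarith

lemma good_of_isCoprime {A : Type*} [CommRing A] (f : QO →+* A) (hC : Good (f s) 4)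
    (c d : QO) (hcd : IsCoprime c d) : Good (f c) (f d) := by
  induction hn : (nm c).toNat using Nat.strong_induction_on generalizing c d with
  | _ n ih =>
  by_cases hc : c = 0
  · subst hc
    rw [isCoprime_zero_left] at hcd
    exact good_unit_right (hcd.map f) _
  have f4 : f 4 = 4 := map_ofNat f 4
  have f15 : f 15 = 15 := map_ofNat f 15
  have hss : (s * s : QO) = -15 := by ext <;> simp
  have hs2 : f s * f s = -15 := by rw [← map_mul, hss, map_neg, f15]
  have hCm : mkSL 4 (-f s) (f s) 4 (by linear_combination hs2) ∈ elemSubgroup A := Good.mem hC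
  have hCm' : mkSL 4 (f s) (-f s) 4 (by linear_combination hs2) ∈ elemSubgroup A := by
    apply Good.mem
    simpa using (hC.unit_mul_left (isUnit_one.neg))
  have hpos := nm_pos hc
  obtain ⟨k, h | h | h⟩ := exists_descent hc hcd
  all_goals
    apply Good.of_add_right (f (-k))
    rw [← map_mul, ← map_add, show d + -k * c = d - k * c by ring]
    have hd : IsCoprime c (d - k * c) := by
      rw [show d - k * c = d + c * -k by ring]
      exact hcd.add_mul_left_right (-k)
    obtain ⟨p, r, hpr⟩ := hd
    generalize d - k * c = d' at *
  · have := ih _ (by have := nm_nonneg d'; omega) d' (-c) ⟨r, -p, by linear_combination hpr⟩ rfl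
    simpa using this.rotate
  · have := ih _ (by have := nm_nonneg (4 * c + s * d'); omega) (4 * c + s * d') (-s * c + 4 * d')
      ⟨4 * p + s * r, -s * p + 4 * r, by linear_combination hpr + (p * c + r * d') * hss⟩ rfl
    have h2 := this.mul_right hCm'
    simp only [map_add, map_mul, map_neg, f4, mkSL_00, mkSL_01, mkSL_10, mkSL_11] at h2
    convert h2 using 1
    · linear_combination -f c * hs2
    · linear_combination -f d' * hs2
  · have := ih _ (by have := nm_nonneg (4 * c - s * d'); omega) (4 * c - s * d') (s * c + 4 * d')
      ⟨4 * p - s * r, s * p + 4 * r, by linear_combination hpr + (p * c + r * d') * hss⟩ rfl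
    have h2 := this.mul_right hCm
    simp only [map_add, map_sub, map_mul, f4, mkSL_00, mkSL_01, mkSL_10, mkSL_11] at h2
    convert h2 using 1
    · linear_combination -f c * hs2
    · linear_combination -f d' * hs2

end QO

section LiftingExponent

lemma pow_prime_of_coprime {r : ℕ} (hr : r.Prime) {D e : ℤ} (hrD : (r : ℤ) ∣ D)
    (hD : Odd D ∨ 4 ∣ D) (he : IsCoprime e D) :
    ∃ e' : ℤ, (1 + D * e) ^ r = 1 + r * D * e' ∧ IsCoprime e' (r * D) := by
  obtain ⟨D₁, rfl⟩ := hrD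
  rcases hr.eq_two_or_odd' with rfl | hodd
  · have h4 : (2 : ℤ) ∣ D₁ := by
      rcases hD with h | h
      · exact absurd h (by simp [Int.odd_mul])
      · push_cast at h; omega
    obtain ⟨D₂, rfl⟩ := h4
    refine ⟨e * (1 + 2 * D₂ * e), by push_cast; ring, ?_⟩
    have h1 : IsCoprime (1 + 2 * D₂ * e) (2 * D₂) := ⟨1, -e, by ring⟩
    have h2 : IsCoprime (1 + 2 * D₂ * e) 2 := h1.of_mul_right_left
    have h3 : IsCoprime e 2 := by
      push_cast at he; exact he.of_mul_right_left
    exact IsCoprime.mul_right (by push_cast; exact h3.mul_left h2) (he.mul_left (by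
      push_cast; exact h2.mul_right h1))
  · obtain ⟨D, hD'⟩ : ∃ D, D = (r : ℤ) * D₁ := ⟨_, rfl⟩
    rw [← hD'] at he ⊢
    have h3 : 3 ≤ r := by have := hr.two_le; obtain ⟨t, ht⟩ := hodd; omega
    have hsum : ∃ y : ℤ, ∑ k ∈ Finset.Ioo 0 r,
        (1 : ℤ) ^ (k - 1) * (D * e) ^ (r - k - 1) * ((r.choose k / r : ℕ) : ℤ) = 1 + D * y := by
      have hmem : r - 1 ∈ Finset.Ioo 0 r := by simp; omega
      rw [← Finset.add_sum_erase _ _ hmem]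
      have hch : r.choose (r - 1) = r := by
        rw [Nat.choose_symm (by omega : 1 ≤ r), Nat.choose_one_right]
      have h0 : r - (r - 1) - 1 = 0 := by omega
      rw [hch, Nat.div_self hr.pos, h0]
      have : D ∣ ∑ k ∈ (Finset.Ioo 0 r).erase (r - 1),
          (1 : ℤ) ^ (k - 1) * (D * e) ^ (r - k - 1) * ((r.choose k / r : ℕ) : ℤ) := by
        refine Finset.dvd_sum fun k hk => ?_
        simp only [Finset.mem_erase, Finset.mem_Ioo] at hk
        obtain ⟨m, hm⟩ : ∃ m, r - k - 1 = m + 1 := ⟨r - k - 2, by omega⟩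
        rw [hm, pow_succ]
        exact ⟨1 ^ (k - 1) * (D * e) ^ m * e * ((r.choose k / r : ℕ) : ℤ), by ring⟩
      obtain ⟨y, hy⟩ := this
      exact ⟨y, by rw [hy]; simp⟩
    obtain ⟨y, hy⟩ := hsum
    have hpow := add_pow_prime_eq hr (1 : ℤ) (D * e)
    rw [hy] at hpow
    obtain ⟨m, rfl⟩ : ∃ m, r = m + 3 := ⟨r - 3, by omega⟩
    refine ⟨e * (1 + D * (y + D₁ * D ^ m * e ^ (m + 2))), ?_, ?_⟩
    · rw [hpow]
      linear_combination (D ^ m * e ^ (m + 3) * D ^ 2) * hD'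
    · have h1 : IsCoprime (e * (1 + D * (y + D₁ * D ^ m * e ^ (m + 2)))) D :=
        he.mul_left ⟨1, -(y + D₁ * D ^ m * e ^ (m + 2)), by ring⟩
      refine IsCoprime.mul_right ?_ h1
      rw [hD'] at h1 ⊢
      exact h1.of_mul_right_left

lemma pow_of_coprime (k : ℕ) : ∀ {D e : ℤ} (M : ℕ), (k : ℤ) ∣ D ^ M → k ≠ 0 →
    (Odd D ∨ 4 ∣ D) → IsCoprime e D →
    ∃ e' : ℤ, (1 + D * e) ^ k = 1 + k * D * e' ∧ IsCoprime e' D := by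
  induction k using induction_on_primes with
  | zero => intro D e M _ h; exact absurd rfl h
  | one => intro D e M _ _ _ h; exact ⟨e, by simp, h⟩
  | prime_mul r k hr ih =>
    intro D e M hk h0 hD he
    have hrD : (r : ℤ) ∣ D :=
      (Nat.prime_iff_prime_int.1 hr).dvd_of_dvd_pow (dvd_trans ⟨k, by push_cast; ring⟩ hk)
    obtain ⟨e₁, h1, h2⟩ := pow_prime_of_coprime hr hrD hD he
    have hD' : Odd ((r : ℤ) * D) ∨ 4 ∣ (r : ℤ) * D := by
      rcases hD with h | h
      · left
        obtain ⟨c, rfl⟩ := hrD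
        exact (Int.odd_mul.1 h).1.mul h
      · right; exact h.mul_left _
    obtain ⟨e₂, h3, h4⟩ := ih M (dvd_trans (dvd_trans ⟨r, by push_cast; ring⟩ hk)
      (pow_dvd_pow_of_dvd (Dvd.intro_left _ rfl) M)) (by rintro rfl; simp at h0) hD' h2
    refine ⟨e₂, ?_, h4.of_mul_right_right⟩
    rw [pow_mul, h1, h3]; push_cast; ring

lemma dvd_pow_of_dvd_pow {D q W M : ℕ} (hW : W ≠ 0) (hDW : D ∣ W) (hq : q ≠ 0)
    (hDq : D ∣ q ^ M) : D ∣ q ^ W := by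
  have hD : D ≠ 0 := by rintro rfl; simp at hDW; exact hW hDW
  rw [← Nat.factorization_le_iff_dvd hD (pow_ne_zero _ hq)]
  intro r
  have h1 := (Nat.factorization_le_iff_dvd hD hW).2 hDW r
  have h2 := (Nat.factorization_le_iff_dvd hD (pow_ne_zero _ hq)).2 hDq r
  have h3 := Nat.factorization_lt r hW
  rw [Nat.factorization_pow] at h2 ⊢
  simp only [Finsupp.smul_apply, smul_eq_mul] at h2 ⊢
  rcases Nat.eq_zero_or_pos (q.factorization r) with h | h
  · rw [h] at h2 ⊢; omega
  · nlinarith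

/-- If `x ≡ 1 mod q` but `gcd(x - 1, q^∞)` is bounded by `W`, then powers of `x` exhaust
`1 + q^N ℤ` modulo `q^(2N)` for `N ≥ W`. -/
lemma exists_pow_eq {q : ℕ} {x : ℤ} {W N : ℕ} (hq : Odd q ∨ 4 ∣ q) (hx : (q : ℤ) ∣ x - 1)
    (hq0 : q ≠ 0) (hW : W ≠ 0) (hWN : W ≤ N)
    (h : ∀ D : ℕ, (D : ℤ) ∣ x - 1 → D ∣ q ^ (2 * N) → D ∣ W) (t : ℤ) :
    ∃ k : ℕ, (q : ℤ) ^ (2 * N) ∣ x ^ k - (1 + q ^ N * t) := by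
  have hQ0 : q ^ (2 * N) ≠ 0 := pow_ne_zero _ hq0
  set D := Nat.gcd (x - 1).natAbs (q ^ (2 * N)) with hDdef
  have hDx : (D : ℤ) ∣ x - 1 := Int.natCast_dvd.2 (Nat.gcd_dvd_left _ _)
  have hDq : D ∣ q ^ (2 * N) := Nat.gcd_dvd_right _ _
  have hDpos : 0 < D := Nat.gcd_pos_of_pos_right _ (Nat.pos_of_ne_zero hQ0)
  have hDN : D ∣ q ^ N := (dvd_pow_of_dvd_pow hW (h D hDx hDq) hq0 hDq).trans
    (pow_dvd_pow _ hWN)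
  have hqD : q ∣ D := Nat.dvd_gcd (Int.natCast_dvd.1 hx) (dvd_pow_self _ (by omega))
  obtain ⟨e, he⟩ := hDx
  obtain ⟨k, hk⟩ := hDN
  have heq : IsCoprime e (q : ℤ) := by
    rw [Int.isCoprime_iff_gcd_eq_one]
    by_contra hne
    obtain ⟨r, hr, hrd⟩ := Nat.exists_prime_and_dvd hne
    have hre : (r : ℤ) ∣ e := (Int.natCast_dvd_natCast.2 hrd).trans (Int.gcd_dvd_left ..)
    have hrq : r ∣ q :=
      Int.natCast_dvd_natCast.1 ((Int.natCast_dvd_natCast.2 hrd).trans (Int.gcd_dvd_right ..))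
    have h1 : D * r ∣ D := by
      apply Nat.dvd_gcd
      · rw [← Int.natCast_dvd, he]; push_cast; exact mul_dvd_mul_left _ hre
      · have : D * r ∣ q ^ N * q := mul_dvd_mul ⟨k, hk⟩ hrq
        rw [← pow_succ] at this
        exact this.trans (pow_dvd_pow _ (by omega))
    have := Nat.le_of_dvd hDpos h1
    have := hr.two_le
    nlinarith
  have hDN' : (D : ℤ) ∣ (q : ℤ) ^ N := ⟨k, by exact_mod_cast hk⟩
  have heD : IsCoprime e (D : ℤ) := (heq.pow_right (n := N)).of_isCoprime_of_dvd_right hDN'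
  have hD4 : Odd (D : ℤ) ∨ 4 ∣ (D : ℤ) := by
    rcases hq with h' | h'
    · left
      have : Odd ((q : ℤ) ^ N) := (by exact_mod_cast h' : Odd (q : ℤ)).pow
      obtain ⟨c, hc⟩ := hDN'
      rw [hc] at this
      exact (Int.odd_mul.1 this).1
    · right; exact_mod_cast h'.trans hqD
  have hk0 : k ≠ 0 := by rintro rfl; exact pow_ne_zero _ hq0 (by simpa using hk)
  obtain ⟨m, hm, hmD⟩ := pow_of_coprime k (D := D) (e := e) N
    (by
      have h1 : (k : ℤ) ∣ (q : ℤ) ^ N := ⟨D, by rw [mul_comm]; exact_mod_cast hk⟩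
      exact h1.trans (pow_dvd_pow_of_dvd (Int.natCast_dvd_natCast.2 hqD) _))
    hk0 hD4 heD
  have hxk : x ^ k = 1 + (q : ℤ) ^ N * m := by
    rw [show x = 1 + D * e by linarith, hm]
    have : (q : ℤ) ^ N = D * k := by exact_mod_cast hk
    rw [this]; ring
  have hmq : IsCoprime m ((q : ℤ) ^ N) :=
    (hmD.of_isCoprime_of_dvd_right (Int.natCast_dvd_natCast.2 hqD)).pow_right
  obtain ⟨a, b, hab⟩ := hmq
  have hqN : (0 : ℤ) < (q : ℤ) ^ N := by positivity
  obtain ⟨n, hn⟩ : ∃ n : ℕ, (q : ℤ) ^ N ∣ n - a * t := by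
    refine ⟨((a * t) % ((q : ℤ) ^ N)).toNat, ?_⟩
    rw [Int.toNat_of_nonneg (Int.emod_nonneg _ hqN.ne')]
    exact (Int.mod_modEq (a * t) ((q : ℤ) ^ N)).symm.dvd
  refine ⟨k * n, ?_⟩
  rw [pow_mul x, hxk]
  obtain ⟨z, hz⟩ : ∃ z : ℤ, (1 + (q : ℤ) ^ N * m) ^ n = 1 + n * ((q : ℤ) ^ N * m) +
      z * ((q : ℤ) ^ N * m) ^ 2 := by
    obtain ⟨z, hz⟩ := Polynomial.powAddExpansion (1 : ℤ) ((q : ℤ) ^ N * m) n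
    exact ⟨z, by rw [hz]; simp⟩
  obtain ⟨y, hy⟩ := hn
  rw [hz, two_mul, pow_add]
  refine ⟨y * m + z * m ^ 2 - b * t, ?_⟩
  linear_combination (q : ℤ) ^ N * m * hy + (q : ℤ) ^ N * t * hab

end LiftingExponent

namespace QO

lemma intCast_dvd_intCast {a b : ℤ} : ((a : QO) ∣ (b : QO)) ↔ a ∣ b := by
  constructor
  · rintro ⟨c, hc⟩
    refine ⟨c.re, ?_⟩
    simpa using congrArg QuadraticAlgebra.re hc
  · rintro ⟨c, rfl⟩
    exact ⟨c, by push_cast; rfl⟩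

lemma isCoprime_intCast {a b : ℤ} (h : IsCoprime (a : QO) (b : QO)) : IsCoprime a b := by
  obtain ⟨x, y, hxy⟩ := h
  exact ⟨x.re, y.re, by simpa using congrArg QuadraticAlgebra.re hxy⟩

lemma IsCoprime.star {a b : QO} (h : IsCoprime a b) : IsCoprime (star a) (star b) :=
  h.map (starRingEnd QO)

lemma star_intCast (a : ℤ) : star (a : QO) = a := by
  ext <;> simp

lemma dvd_nm (x : QO) : x ∣ (nm x : QO) := ⟨_, (self_mul_star x).symm⟩

lemma nm_star (x : QO) : nm (star x) = nm x := QuadraticAlgebra.norm_star x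

lemma isCoprime_intCast_nm {a : ℤ} {x : QO} (h : IsCoprime (a : QO) x) : IsCoprime a (nm x) := by
  apply isCoprime_intCast
  rw [← self_mul_star]
  refine h.mul_right ?_
  have := IsCoprime.star h
  rwa [star_intCast] at this

lemma pow_nm_dvd_of_pow_dvd {τ : QO} (hτ : IsCoprime τ (star τ)) {k : ℕ} {n : ℤ}
    (h : τ ^ k ∣ (n : QO)) : nm τ ^ k ∣ n := by
  rw [← intCast_dvd_intCast]
  push_cast
  rw [← self_mul_star, mul_pow]
  refine (hτ.pow (m := k) (n := k)).mul_dvd h ?_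
  obtain ⟨z, hz⟩ := h
  refine ⟨star z, ?_⟩
  rw [← star_pow, ← star_mul', ← hz, star_intCast]

lemma exists_intCast_modEq {τ : QO} (hτ : IsCoprime τ (star τ)) (k : ℕ) (x : QO) :
    ∃ a : ℤ, τ ^ k ∣ x - a := by
  obtain ⟨y, hy⟩ : ∃ y, y = τ ^ k := ⟨_, rfl⟩
  have hc : IsCoprime y (star y) := by
    rw [hy, star_pow]; exact hτ.pow
  rw [← hy]
  have h1 : y - star y = (y.im : QO) * s := by
    ext <;> simp
    ring
  have h2 : IsCoprime ((y.im : ℤ) : QO) y := by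
    have : IsCoprime (y - star y) y := by
      rw [show y - star y = -star y + y * 1 by ring]
      exact hc.symm.neg_left.add_mul_left_left 1
    rw [h1] at this
    exact this.of_mul_left_left
  obtain ⟨u, v, huv⟩ := isCoprime_intCast_nm h2
  have huv' : (u : QO) * y.im + v * nm y = 1 := by exact_mod_cast huv
  obtain ⟨c, hc'⟩ := dvd_nm y
  refine ⟨x.re - x.im * u * y.re, ?_⟩
  refine ⟨x.im * u + x.im * w * v * c, ?_⟩
  have hy' := eq_add y
  have hx' := eq_add x
  push_cast
  rw [hc'] at huv'
  linear_combination hx' - x.im * w * huv' - x.im * u * hy'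

lemma exists_dvd_pow_mul_pow_sub_one {m : QO} (hm : m ≠ 0) (π : QO) :
    ∃ i t : ℕ, t ≠ 0 ∧ m ∣ π ^ i * (π ^ t - 1) := by
  have hn := nm_pos hm
  obtain ⟨n, hn'⟩ : ∃ n : ℕ, (n : ℤ) = nm m := ⟨(nm m).toNat, Int.toNat_of_nonneg hn.le⟩
  have : NeZero n := ⟨by rintro rfl; simp at hn'; omega⟩
  obtain ⟨i, j, hij, he⟩ := Finite.exists_ne_map_eq_of_infinite
    (fun i : ℕ => (((π ^ i).re : ZMod n), ((π ^ i).im : ZMod n)))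
  wlog hlt : i < j generalizing i j
  · exact this j i hij.symm he.symm (by omega)
  simp only [Prod.mk.injEq] at he
  have h1 := (ZMod.intCast_eq_intCast_iff_dvd_sub _ _ _).1 he.1
  have h2 := (ZMod.intCast_eq_intCast_iff_dvd_sub _ _ _).1 he.2
  refine ⟨i, j - i, by omega, ?_⟩
  have h3 : (nm m : QO) ∣ π ^ j - π ^ i := by
    obtain ⟨a, ha⟩ := h1
    obtain ⟨b, hb⟩ := h2
    rw [hn'] at ha hb
    refine ⟨⟨a, b⟩, ?_⟩
    ext
    · simp [ha]
    · simp [hb]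
  rw [mul_sub, ← pow_add, mul_one, Nat.add_sub_cancel' hlt.le]
  exact (dvd_nm m).trans h3

lemma exists_pow_sub_one_dvd {m π : QO} (hm : m ≠ 0) (h : IsCoprime π m) :
    ∃ t : ℕ, t ≠ 0 ∧ m ∣ π ^ t - 1 := by
  obtain ⟨i, t, ht, hd⟩ := exists_dvd_pow_mul_pow_sub_one hm π
  exact ⟨t, ht, (h.symm.pow_right).dvd_of_dvd_mul_left hd⟩

/-- Powers of an element of infinite order approximate `1 - τ ^ N` modulo `τ ^ (2N)`. -/
lemma exists_pow_approx {τ π : QO} (hτ : IsCoprime τ (star τ)) (hq : Odd (nm τ) ∨ 4 ∣ nm τ)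
    (hπ : IsCoprime π τ) (hroot : ∀ n : ℕ, n ≠ 0 → π ^ n ≠ 1) :
    ∃ W : ℕ, ∀ N ≥ W, ∃ i : ℕ, τ ^ (2 * N) ∣ π ^ (2 * i) - (1 - τ ^ N) := by
  have hτ0 : τ ≠ 0 := by
    rintro rfl
    exact not_isCoprime_zero_zero (by simpa using hτ)
  have hnpos := nm_pos hτ0
  obtain ⟨q, hq'⟩ : ∃ q : ℕ, (q : ℤ) = nm τ := ⟨(nm τ).toNat, Int.toNat_of_nonneg hnpos.le⟩
  obtain ⟨i₀, hi0, hi₀⟩ := exists_pow_sub_one_dvd hτ0 hπ.pow_left (π := π ^ 2)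
  rw [← pow_mul] at hi₀
  have hW : nm (π ^ (2 * i₀) - 1) ≠ 0 :=
    (nm_pos (sub_ne_zero.2 (hroot _ (by omega)))).ne'
  refine ⟨(nm (π ^ (2 * i₀) - 1)).natAbs, fun N hN => ?_⟩
  have hN1 : 1 ≤ N := le_trans (by omega) hN
  obtain ⟨g, hg⟩ := exists_intCast_modEq hτ (2 * N) (π ^ 2)
  obtain ⟨t', ht'⟩ := exists_intCast_modEq hτ (2 * N) (τ ^ N)
  have hx : τ ^ (2 * N) ∣ π ^ (2 * i₀) - ((g ^ i₀ : ℤ) : QO) := by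
    rw [pow_mul π]; push_cast
    exact hg.trans (sub_dvd_pow_sub_pow _ _ _)
  have hqx : (q : ℤ) ∣ g ^ i₀ - 1 := by
    rw [hq', ← pow_one (nm τ)]
    apply pow_nm_dvd_of_pow_dvd hτ
    have h1 := (pow_dvd_pow τ (show 1 ≤ 2 * N by omega)).trans hx
    rw [pow_one] at h1 ⊢
    have := dvd_sub hi₀ h1
    push_cast at this ⊢
    convert this using 1; ring
  have htq : (q : ℤ) ^ N ∣ t' := by
    rw [hq']
    apply pow_nm_dvd_of_pow_dvd hτ
    have := dvd_sub (dvd_refl (τ ^ N)) ((pow_dvd_pow τ (show N ≤ 2 * N by omega)).trans ht')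
    simpa using this
  obtain ⟨t, rfl⟩ := htq
  have hq4 : Odd q ∨ 4 ∣ q := by
    rw [← hq'] at hq
    exact_mod_cast hq
  obtain ⟨k, hk⟩ := exists_pow_eq (x := g ^ i₀) (N := N) hq4 hqx
    (by rintro rfl; simp at hq'; omega) (by omega) hN (by
      intro D hD1 hD2
      obtain ⟨z, hz⟩ := hx
      rw [← Int.natCast_dvd]
      have e1 : π ^ (2 * i₀) - 1 = ((g ^ i₀ - 1 : ℤ) : QO) + τ ^ (2 * N) * z := by
        rw [← hz]; push_cast; ring
      have e2 : ∀ (a : ℤ) (y : QO), nm (a + y) = a * (a + 2 * y.re + y.im) + nm y := by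
        intro a y; simp only [nm_def]; simp; ring
      rw [e1, e2]
      refine dvd_add (hD1.mul_right _) ?_
      rw [nm_mul, nm, map_pow, ← nm, ← hq']
      have : (D : ℤ) ∣ (q : ℤ) ^ (2 * N) := by exact_mod_cast hD2
      exact this.mul_right _) (-t)
  refine ⟨i₀ * k, ?_⟩
  have h1 : τ ^ (2 * N) ∣ π ^ (2 * (i₀ * k)) - (((g ^ i₀) ^ k : ℤ) : QO) := by
    rw [← mul_assoc, pow_mul π (2 * i₀)]; push_cast at hx ⊢
    exact hx.trans (sub_dvd_pow_sub_pow _ _ _)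
  have h2 : τ ^ (2 * N) ∣ (((g ^ i₀) ^ k : ℤ) : QO) - ((1 + q ^ N * -t : ℤ) : QO) := by
    rw [← Int.cast_sub]
    refine dvd_trans ?_ (intCast_dvd_intCast.2 hk)
    push_cast
    rw [show (q : QO) = ((q : ℤ) : QO) by push_cast; rfl, hq']
    exact pow_dvd_pow_of_dvd (dvd_nm τ) _
  have := dvd_add (dvd_add h1 h2) ht'
  push_cast at this
  convert this using 1; ring


/-- `f` exhibits `A` as a localization of `QO` that inverts `P`, where `P` is divisible by every
prime that becomes invertible, in a setting of finite class number. -/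
structure IsSLocalization {A : Type*} [CommRing A] (f : QO →+* A) (P : QO) : Prop where
  inj : Function.Injective f
  isUnit : IsUnit (f P)
  pow_ne_one : ∀ n : ℕ, n ≠ 0 → P ^ n ≠ 1
  exists_mul_eq : ∀ a : A, ∃ (k : ℕ) (x : QO), f P ^ k * a = f x
  exists_pow_eq : ∀ d : QO, d ≠ 0 → ∃ (h : ℕ) (δ g : QO), IsUnit (f δ) ∧ d ^ (h + 1) = δ * g ∧
    IsCoprime g P

lemma two_dvd_w'_pow_sub (M : ℕ) (hM : 1 ≤ M) : ∃ z, w' ^ M = w' + 2 * z := by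
  have h : w' * w' = w' + 2 * (-2) := by ext <;> simp
  induction M, hM using Nat.le_induction with
  | base => exact ⟨0, by simp⟩
  | succ n _ ih =>
    obtain ⟨z, hz⟩ := ih
    exact ⟨-2 + z * w', by rw [pow_succ, hz]; linear_combination h⟩

section

variable {A : Type*} [CommRing A] {f : QO →+* A}

lemma good_s_four_of_good (M : ℕ) (hM : 1 ≤ M) (h : Good (-(f w' ^ M) ^ 2) (1 - 2 * f w' ^ M)) :
    Good (f s) 4 := by
  have h1 : Good 4 (1 - 2 * f w' ^ M) := h.transpose (a := 1 + 2 * f w' ^ M) (b := 4) (by ring)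
  obtain ⟨z, hz⟩ := two_dvd_w'_pow_sub M hM
  have hz' : f w' ^ M = f w' + 2 * f z := by
    rw [← map_pow, hz, map_add, map_mul, map_ofNat]
  have hs : f s = 1 - 2 * f w' := by
    rw [show s = 1 - 2 * w' by ext <;> simp, map_sub, map_one, map_mul, map_ofNat]
  have h2 := (h1.rotate.unit_mul_left (u := -1) (by simp)).add_left (f z)
  rw [hs]
  convert h2 using 1
  rw [hz']; ring

lemma good_s_four {P : QO} (hf : IsSLocalization f P) (hw : IsUnit (f w') ∨ IsCoprime P w') :
    Good (f s) 4 := by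
  obtain hw | hw := hw
  · exact good_s_four_of_good 1 le_rfl (good_unit_left (((hw.pow 1).pow 2).neg) _)
  · have hcop : IsCoprime w' (star w') := ⟨1, 1, by ext <;> simp⟩
    obtain ⟨W, hW⟩ := exists_pow_approx hcop (.inr ⟨1, by rw [nm_def]; simp⟩) hw hf.pow_ne_one
    obtain ⟨i, z, hz⟩ := hW (W + 1) (by omega)
    apply good_s_four_of_good (W + 1) (by omega)
    obtain ⟨m, hm⟩ : ∃ m, m = f w' ^ (W + 1) := ⟨_, rfl⟩
    obtain ⟨v, hv⟩ : ∃ v, v = f P ^ (2 * i) := ⟨_, rfl⟩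
    have hvu : IsUnit v := hv ▸ hf.isUnit.pow _
    have hz' : v - (1 - m) = m ^ 2 * f z := by
      have := congrArg f hz
      simp only [map_sub, map_pow, map_one, map_mul] at this
      rw [hv, hm, this, ← pow_mul, mul_comm 2]
    rw [← hm]
    have h1 : Good (m ^ 2 + (v + m) * (v - m)) (v - m) := by
      rw [show m ^ 2 + (v + m) * (v - m) = v ^ 2 by ring]
      exact good_unit_left (hvu.pow 2) _
    have h2 := (h1.of_add_left).unit_mul_left (u := -1) (by simp)
    refine Good.of_add_right (-f z) ?_
    convert h2 using 1
    · ring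
    · linear_combination -hz'

lemma elemSubgroup_eq_top {P : QO} (hf : IsSLocalization f P)
    (hw : IsUnit (f w') ∨ IsCoprime P w') : elemSubgroup A = ⊤ := by
  have hC := good_s_four hf hw
  have key : ∀ c d : QO, d ≠ 0 → IsCoprime (f c) (f d) → Good (f c) (f d) := by
    intro c d hd hcd
    obtain ⟨h, δ, g, hδ, hdg, hg⟩ := hf.exists_pow_eq d hd
    obtain ⟨ε, hε⟩ := hδ.exists_left_inv
    have hfg : f g = ε * f d ^ h * f d := by
      have := congrArg f hdg
      rw [map_mul, map_pow] at this
      linear_combination (-f g) * hε - ε * this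
    apply Good.of_unit_mul_left hf.isUnit
    apply Good.of_add_left (ε * f d ^ h)
    rw [← hfg, ← map_mul, ← map_add]
    apply good_of_isCoprime f hC
    have hcd' : IsCoprime (f (P * c + g)) (f d) := by
      rw [map_add, hfg, map_mul]
      refine IsCoprime.add_mul_right_left ?_ _
      exact (isCoprime_mul_unit_left_left hf.isUnit _ _).2 hcd
    have hP : IsCoprime (P * c + g) P := hg.mul_add_right_left c |> fun h => by
      simpa [add_comm] using h
    obtain ⟨a, b, hab⟩ := hcd'
    obtain ⟨k, x, hx⟩ := hf.exists_mul_eq a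
    obtain ⟨l, y, hy⟩ := hf.exists_mul_eq b
    have e : P ^ l * x * (P * c + g) + P ^ k * y * d = P ^ (k + l) := by
      apply hf.inj
      rw [map_add, map_mul, map_mul, map_mul, map_mul, map_pow, map_pow, map_pow, ← hx, ← hy]
      rw [pow_add]
      linear_combination f P ^ k * f P ^ l * hab
    have h3 : IsCoprime (P * c + g) (P ^ (k + l)) := hP.pow_right
    rw [← e] at h3
    have h4 : IsCoprime (P * c + g) (P ^ k * y * d) := by
      rw [show P ^ k * y * d = (P ^ l * x * (P * c + g) + P ^ k * y * d) +
        (P * c + g) * -(P ^ l * x) by ring]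
      exact h3.add_mul_left_right _
    exact h4.of_mul_right_right
  rw [eq_top_iff]
  rintro γ -
  apply Good.mem
  have hdet := sl_det γ
  obtain ⟨c, hc⟩ : ∃ c, c = γ 1 0 := ⟨_, rfl⟩
  obtain ⟨d, hd⟩ : ∃ d, d = γ 1 1 := ⟨_, rfl⟩
  have hcop : IsCoprime c d := ⟨-γ 0 1, γ 0 0, by rw [hc, hd]; linear_combination hdet⟩
  rw [← hc, ← hd]
  by_cases hd0 : d = 0
  · subst hd0
    rw [isCoprime_zero_right] at hcop
    exact good_unit_left hcop _
  obtain ⟨k, x, hx⟩ := hf.exists_mul_eq c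
  obtain ⟨l, y, hy⟩ := hf.exists_mul_eq d
  apply Good.of_unit_mul_left (hf.isUnit.pow k)
  apply Good.of_unit_mul_right (hf.isUnit.pow l)
  rw [hx, hy]
  apply key
  · rintro rfl
    rw [map_zero] at hy
    exact hd0 ((hf.isUnit.pow l).mul_right_eq_zero.1 hy)
  · rw [← hx, ← hy]
    exact (isCoprime_mul_unit_left_left (hf.isUnit.pow k) _ _).2
      ((isCoprime_mul_unit_left_right (hf.isUnit.pow l) _ _).2 hcop)

end

end QO

section Relations

variable {A : Type*} [CommRing A]

variable (A) in
/-- The homomorphism sending `x` to the class of `e12 x` in the abelianization. -/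
def elemHom : A →+ SL2ab A where
  toFun x := Additive.ofMul (Abelianization.of (e12 x))
  map_zero' := by
    have : e12 (0 : A) = 1 := by apply sl_ext <;> rfl
    rw [this, map_one, ofMul_one]
  map_add' x y := by rw [e12_add, map_mul, ofMul_mul]

lemma elemHom_apply (x : A) : elemHom A x = Additive.ofMul (Abelianization.of (e12 x)) := rfl

lemma ofMul_of_mul (g h : Matrix.SpecialLinearGroup (Fin 2) A) :
    Additive.ofMul (Abelianization.of (g * h)) =
      Additive.ofMul (Abelianization.of g) + Additive.ofMul (Abelianization.of h) := by
  rw [map_mul, ofMul_mul]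

lemma ofMul_of_e21 (x : A) : Additive.ofMul (Abelianization.of (e21 x)) = -elemHom A x := by
  have h : mkSL 0 (-1) 1 0 (by ring) * e12 (-x) = e21 x * mkSL 0 (-1) 1 0 (by ring) := by
    apply sl_ext <;> simp [sl_mul]
  have := congrArg (fun g => Additive.ofMul (Abelianization.of g)) h
  simp only [ofMul_of_mul] at this
  rw [← elemHom_apply, add_comm, add_left_inj] at this
  rw [← this, map_neg]

lemma elemHom_surjective (h : elemSubgroup A = ⊤) : Function.Surjective (elemHom A) := by
  intro y
  obtain ⟨g, hg⟩ : ∃ g, Abelianization.of g = Additive.toMul y :=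
    QuotientGroup.mk'_surjective _ _
  have hmem : g ∈ elemSubgroup A := h ▸ Subgroup.mem_top g
  suffices ∃ x, elemHom A x = Additive.ofMul (Abelianization.of g) by
    obtain ⟨x, hx⟩ := this
    exact ⟨x, by rw [hx, hg]; rfl⟩
  clear hg
  induction hmem using Subgroup.closure_induction with
  | mem g hg =>
    obtain ⟨x, rfl⟩ | ⟨x, rfl⟩ := hg
    · exact ⟨x, rfl⟩
    · exact ⟨-x, by rw [ofMul_of_e21, map_neg]⟩
  | one => exact ⟨0, by rw [map_zero, map_one, ofMul_one]⟩
  | mul g h _ _ hg hh =>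
    obtain ⟨x, hx⟩ := hg
    obtain ⟨y, hy⟩ := hh
    exact ⟨x + y, by rw [map_add, hx, hy, ofMul_of_mul]⟩
  | inv g _ hg =>
    obtain ⟨x, hx⟩ := hg
    exact ⟨-x, by rw [map_neg, hx, map_inv, ofMul_inv]⟩

variable (A) in
/-- The additive relations between the classes of elementary matrices. -/
def relKer : AddSubgroup A := (elemHom A).ker

lemma mem_relKer {x : A} : x ∈ relKer A ↔ elemHom A x = 0 := Iff.rfl

lemma elemHom_sq_mul {u v : A} (huv : u * v = 1) (x : A) :
    elemHom A (u ^ 2 * x) = elemHom A x := by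
  have h : mkSL u 0 0 v (by linear_combination huv) * e12 x =
      e12 (u ^ 2 * x) * mkSL u 0 0 v (by linear_combination huv) := by
    apply sl_ext <;> simp [sl_mul]
    linear_combination (-u * x) * huv
  have := congrArg (fun g => Additive.ofMul (Abelianization.of g)) h
  simp only [ofMul_of_mul] at this
  rw [← elemHom_apply, ← elemHom_apply, add_comm, add_left_inj] at this
  exact this.symm

lemma sq_sub_one_mul_mem {u : A} (hu : IsUnit u) (x : A) : (u ^ 2 - 1) * x ∈ relKer A := by
  obtain ⟨v, huv⟩ := hu.exists_right_inv
  rw [mem_relKer, sub_mul, one_mul, map_sub, elemHom_sq_mul huv, sub_self]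

lemma sq_mul_mem {u x : A} (hu : IsUnit u) (h : x ∈ relKer A) : u ^ 2 * x ∈ relKer A := by
  obtain ⟨v, huv⟩ := hu.exists_right_inv
  rwa [mem_relKer, elemHom_sq_mul huv]

/-- The basic relation, from two factorizations of a matrix with lower left entry `u`. -/
lemma mem_relKer_of_eq_unit {x y₁ y₂ u v : A} (h : y₁ + y₂ + x * y₁ * y₂ = u) (huv : u * v = 1) :
    (x + u) * (u - y₁ - y₂) * v ∈ relKer A := by
  have e' : e12 (-v) * e21 u * e12 (-v) = mkSL 0 (-v) u 0 (by linear_combination huv) := by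
    apply sl_ext <;> simp [sl_mul]
    · linear_combination -huv
    · linear_combination -v * huv
    · linear_combination -huv
  have e : e21 y₁ * e12 x * e21 y₂ =
      e12 ((1 + x * y₂) * v) * (e12 (-v) * e21 u * e12 (-v)) * e12 ((1 + x * y₁) * v) := by
    rw [e']
    apply sl_ext <;> simp [sl_mul]
    · linear_combination -(1 + x * y₂) * huv
    · linear_combination (-(1 + x * y₁) * (1 + x * y₂) * v - x) * huv - v * x * h
    · linear_combination h
    · linear_combination -(1 + x * y₁) * huv
  have := congrArg (fun g => Additive.ofMul (Abelianization.of g)) e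
  simp only [ofMul_of_mul, ofMul_of_e21, ← elemHom_apply, ← map_neg, ← map_add] at this
  rw [← sub_eq_zero, ← map_sub] at this
  rw [mem_relKer, ← this]
  congr 1
  linear_combination (x + u - y₁ - y₂) * huv

lemma twelve_mem_relKer : (12 : A) ∈ relKer A := by
  have := mem_relKer_of_eq_unit (A := A) (x := -2) (y₁ := 1) (y₂ := 2) (u := -1) (v := -1)
    (by norm_num) (by norm_num)
  have h := neg_mem this
  convert h using 1
  norm_num

lemma mem_relKer_of_mul_eq {v v' x y : A} (hv : v * v' = 1) (hxy : x * y = v - 1) :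
    (v - 1) * (x - y + 2 - v) * v' ∈ relKer A := by
  have h := mem_relKer_of_eq_unit (A := A) (x := x) (y₁ := y) (y₂ := (1 - y) * v') (u := 1) (v := 1)
    (by linear_combination ((1 - y) * v') * hxy + (1 - y) * hv) (by norm_num)
  convert h using 1
  linear_combination (x - y + 2 - v) * hv + (1 - v') * hxy

lemma sq_sub_one_mem_relKer {J : Ideal A} (hJ : ∀ a ∈ J, a ∈ relKer A) {v τ x : A}
    (hv : IsUnit v) (hvx : v = 1 - τ + τ ^ 2 * x) (hm : -1 + τ * x ∈ J) :
    τ ^ 2 - 1 ∈ relKer A := by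
  obtain ⟨v', hv'⟩ := hv.exists_right_inv
  have h := mem_relKer_of_eq_unit (A := A) (x := x) (y₁ := τ ^ 2) (y₂ := v - τ) (u := v ^ 2)
    (v := v' ^ 2) (by rw [hvx]; ring) (by linear_combination (v * v' + 1) * hv')
  have h1 := sq_mul_mem hv h
  have h2 : v ^ 2 * ((x + v ^ 2) * (v ^ 2 - τ ^ 2 - (v - τ)) * v' ^ 2) =
      (x + v ^ 2) * (v ^ 2 - τ ^ 2 - (v - τ)) := by
    linear_combination (x + v ^ 2) * (v ^ 2 - τ ^ 2 - (v - τ)) * (v * v' + 1) * hv'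
  rw [h2] at h1
  obtain ⟨m, hm'⟩ : ∃ m, m = -1 + τ * x := ⟨_, rfl⟩
  have hvm : v = 1 + τ * m := by rw [hvx, hm']; ring
  have hτx : τ * x = m + 1 := by rw [hm']; ring
  have h3 : (x + v ^ 2) * (v ^ 2 - τ ^ 2 - (v - τ)) =
      (m + 1 + (1 + τ * m) ^ 2 * τ) * (m + 1) * (1 + τ * m - τ) := by
    have : v ^ 2 - τ ^ 2 - (v - τ) = (v - τ) * τ * (m + 1) := by rw [hvm]; ring
    rw [this, ← hvm]
    linear_combination (m + 1) * (v - τ) * hτx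
  have h4 : (m + 1 + (1 + τ * m) ^ 2 * τ) * (m + 1) * (1 + τ * m - τ) - (1 - τ ^ 2) ∈ J := by
    rw [← hm'] at hm
    rw [show (m + 1 + (1 + τ * m) ^ 2 * τ) * (m + 1) * (1 + τ * m - τ) - (1 - τ ^ 2) = m *
      ((m + 2 + (1 + τ * m) ^ 2 * τ) * (1 + τ * m - τ) + (2 * τ + τ ^ 2 * m) * τ * (1 + τ * m - τ)
        + (1 + τ) * τ) by ring]
    exact J.mul_mem_right _ hm
  have := sub_mem (hJ _ h4) (h3 ▸ h1)
  convert this using 1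
  ring

end Relations

namespace QO

lemma exists_int_crt (L : ℤ) (hL : L ≠ 0) : ∃ c : ℤ,
    L ∣ (c - 1) * (c - 2) ∧ 8 ∣ c - 2 ∧ IsCoprime (c ^ 2 + 15) L := by
  obtain ⟨k, m, hm, hkm⟩ := Nat.exists_eq_two_pow_mul_odd (Int.natAbs_ne_zero.2 hL)
  have hLd : L ∣ 2 ^ (k + 3) * m := by
    rw [← Int.natAbs_dvd, hkm]
    exact ⟨8, by push_cast; ring⟩
  have hmo : Odd (m : ℤ) := by exact_mod_cast hm
  have hcop : IsCoprime ((2 : ℤ) ^ (k + 3)) m := (Int.isCoprime_two_left.2 hmo).pow_left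
  obtain ⟨u, v, huv⟩ := id hcop
  obtain ⟨c, hc⟩ : ∃ c, c = 1 + v * m := ⟨_, rfl⟩
  have hc2 : c - 2 = 2 ^ (k + 3) * -u := by rw [hc]; linear_combination huv
  refine ⟨c, ?_, ?_, ?_⟩
  · refine hLd.trans ⟨-u * v, ?_⟩
    rw [hc2, hc]; ring
  · rw [hc2]; exact ⟨2 ^ k * -u, by ring⟩
  · refine IsCoprime.of_isCoprime_of_dvd_right (IsCoprime.mul_right ?_ ?_) hLd
    · refine (Int.isCoprime_two_right.2 ?_).pow_right
      have : c = 2 * (1 + 2 ^ (k + 2) * -u) := by linear_combination hc2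
      exact ⟨2 * (1 + 2 ^ (k + 2) * -u) ^ 2 + 7, by rw [this]; ring⟩
    · have : c ^ 2 + 15 = 16 + m * (2 * v + v ^ 2 * m) := by rw [hc]; ring
      rw [this]
      refine IsCoprime.add_mul_left_left ?_ _
      rw [show (16 : ℤ) = 2 ^ 4 by norm_num]
      exact (Int.isCoprime_two_left.2 hmo).pow_left

section

variable {A : Type*} [CommRing A] {f : QO →+* A} {P : QO}

lemma IsSLocalization.ne_zero (hf : IsSLocalization f P) : P ≠ 0 := by
  rintro rfl
  have := hf.isUnit
  rw [map_zero, isUnit_zero_iff, ← map_zero f, ← map_one f] at this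
  exact zero_ne_one (hf.inj this)

lemma IsSLocalization.exists_eq_add_mul (hf : IsSLocalization f P) {n : ℤ} (hn : n ≠ 0) (a : A) :
    ∃ (x : QO) (b : A), a = f x + n * b := by
  obtain ⟨i, t, ht, hd⟩ := exists_dvd_pow_mul_pow_sub_one (m := n) (by exact_mod_cast hn) P
  obtain ⟨k, x, hx⟩ := hf.exists_mul_eq a
  have h1 : (n : A) ∣ f P ^ t - 1 := by
    have := map_dvd f hd
    rw [map_mul, map_intCast] at this
    have hu : IsUnit (f (P ^ i)) := by rw [map_pow]; exact hf.isUnit.pow i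
    simpa using hu.dvd_mul_left.1 this
  have h2 : (n : A) ∣ f P ^ (t * k) - 1 := by
    rw [pow_mul]
    exact h1.trans (by simpa using sub_dvd_pow_sub_pow (f P ^ t) 1 k)
  obtain ⟨b, hb⟩ := h2
  refine ⟨P ^ (t * k - k) * x, -b * a, ?_⟩
  rw [map_mul, map_pow, ← hx, ← mul_assoc, ← pow_add,
    Nat.sub_add_cancel (Nat.le_mul_of_pos_left k (Nat.pos_of_ne_zero ht))]
  linear_combination -a * hb

lemma IsSLocalization.exists_int_mul_mem (hf : IsSLocalization f P) :
    ∃ n : ℤ, 0 < n ∧ P ^ 2 - 1 ∣ (n : QO) ∧ ∀ a : A, n * a ∈ relKer A := by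
  have h0 : P ^ 2 - 1 ≠ 0 := sub_ne_zero.2 (hf.pow_ne_one 2 (by norm_num))
  refine ⟨nm (P ^ 2 - 1), nm_pos h0, dvd_nm _, fun a => ?_⟩
  obtain ⟨z, hz⟩ := map_dvd f (dvd_nm (P ^ 2 - 1))
  rw [map_intCast, map_sub, map_pow, map_one] at hz
  rw [hz, mul_assoc]
  exact sq_sub_one_mul_mem hf.isUnit _

lemma IsSLocalization.eight_mul_mem (hf : IsSLocalization f P) : 8 * (f w + 1) ∈ relKer A := by
  obtain ⟨n, hn, hPn, hnN⟩ := hf.exists_int_mul_mem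
  obtain ⟨c, hcL, hc8, hcop⟩ := exists_int_crt (n * nm P * 15)
    (by have := nm_pos hf.ne_zero; positivity)
  obtain ⟨τ₀, hτ₀⟩ : ∃ τ : QO, τ = (c - 1 : ℤ) + 2 * w := ⟨_, rfl⟩
  have hnm : nm τ₀ = c ^ 2 + 15 := by rw [hτ₀, nm_def]; simp; ring
  have hodd : Odd (c ^ 2 + 15) := by
    obtain ⟨z, hz⟩ := hc8
    have : c = 2 * (1 + 4 * z) := by linarith
    exact ⟨2 * (1 + 4 * z) ^ 2 + 7, by rw [this]; ring⟩
  have cop : ∀ m : QO, IsCoprime (c ^ 2 + 15) (nm m) → IsCoprime τ₀ m := by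
    intro m h
    have h' : IsCoprime ((nm τ₀ : ℤ) : QO) ((nm m : ℤ) : QO) := by
      rw [hnm]; exact h.map (Int.castRingHom QO)
    exact (h'.of_isCoprime_of_dvd_left (dvd_nm _)).of_isCoprime_of_dvd_right (dvd_nm _)
  have hcopn : IsCoprime τ₀ (n : QO) := by
    apply cop
    have : nm (n : QO) = n ^ 2 := by rw [nm_def]; simp
    rw [this]
    exact (hcop.of_mul_right_left.of_mul_right_left).pow_right
  have hcopP : IsCoprime P τ₀ := (cop P hcop.of_mul_right_left.of_mul_right_right).symm
  have hcops : IsCoprime τ₀ (star τ₀) := by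
    have h1 : star τ₀ = (c ^ 2 + 15 : ℤ) * 0 + (-(2 * s) + τ₀ * 1) := by
      rw [hτ₀]; ext <;> simp; ring
    rw [h1, mul_zero, zero_add]
    refine IsCoprime.add_mul_left_right ?_ _
    refine (cop _ ?_).neg_right
    have : nm (2 * s) = 2 ^ 2 * 15 := by rw [nm_def]; simp
    rw [this]
    exact ((Int.isCoprime_two_right.2 hodd).pow_right).mul_right hcop.of_mul_right_right
  obtain ⟨W, hW⟩ := exists_pow_approx hcops (.inl (hnm ▸ hodd)) hcopP hf.pow_ne_one
  obtain ⟨t, ht, htn⟩ := exists_pow_sub_one_dvd (m := n) (by exact_mod_cast hn.ne') hcopn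
  obtain ⟨i, x, hx⟩ := hW (1 + t * W)
    (le_trans (Nat.le_mul_of_pos_left W (Nat.pos_of_ne_zero ht)) (by omega))
  obtain ⟨τ, hτ⟩ : ∃ τ, τ = τ₀ ^ (1 + t * W) := ⟨_, rfl⟩
  have hττ : (n : QO) ∣ τ - τ₀ := by
    rw [hτ, pow_add, pow_one, pow_mul]
    have h := htn.trans (by simpa using sub_dvd_pow_sub_pow (τ₀ ^ t) 1 W)
    exact (h.mul_left τ₀).trans ⟨1, by ring⟩
  rw [mul_comm 2 (1 + t * W), pow_mul τ₀, ← hτ] at hx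
  have hmem : P ^ 2 - 1 ∣ -1 + τ * x := by
    have h1 : IsCoprime (P ^ 2 - 1) τ :=
      (hτ ▸ hcopn.pow_left).symm.of_isCoprime_of_dvd_left hPn
    apply h1.dvd_of_dvd_mul_left
    have : τ * (-1 + τ * x) = (P ^ 2) ^ i - 1 ^ i := by
      rw [← pow_mul, one_pow]; linear_combination -hx
    rw [this]
    exact sub_dvd_pow_sub_pow _ _ _
  have hτN : f τ ^ 2 - 1 ∈ relKer A := by
    refine sq_sub_one_mem_relKer (J := Ideal.span {f P ^ 2 - 1}) (v := f P ^ (2 * i)) (x := f x)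
      ?_ ?_ ?_ ?_
    · intro a ha
      obtain ⟨b, rfl⟩ := Ideal.mem_span_singleton.1 ha
      exact sq_sub_one_mul_mem hf.isUnit b
    · exact hf.isUnit.pow _
    · have := congrArg f hx
      simp only [map_sub, map_pow, map_mul, map_one] at this
      linear_combination this
    · rw [Ideal.mem_span_singleton]
      simpa using map_dvd f hmem
  obtain ⟨y, hy⟩ := hττ
  have hτ₀N : f (τ₀ ^ 2 - 1) ∈ relKer A := by
    have : f (τ₀ ^ 2 - 1) = f τ ^ 2 - 1 - n * f (y * (τ + τ₀)) := by
      rw [← map_pow, ← map_one f, ← map_intCast f, ← map_sub, ← map_mul, ← map_sub]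
      congr 1
      linear_combination -(τ + τ₀) * hy
    rw [this]
    exact sub_mem hτN (hnN _)
  obtain ⟨z, hz⟩ := hcL
  obtain ⟨c', hc'⟩ := hc8
  have key : (8 * (w + 1) : QO) = (3 - c) • (τ₀ ^ 2 - 1) + (n : QO) *
      (z * nm P * 15 * (4 * w + (c - 2))) + (2 - 12 * c') • 12 := by
    have hw : w * w = w - 4 := by ext <;> simp
    have hz' : ((c : QO) - 1) * (c - 2) = n * nm P * 15 * z := by exact_mod_cast hz
    have hc2 : (c : QO) - 2 = 8 * c' := by exact_mod_cast hc'
    rw [zsmul_eq_mul, zsmul_eq_mul, hτ₀]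
    push_cast
    linear_combination (4 * w + (c - 2)) * hz' + (-4 * (3 - c)) * hw - 18 * hc2
  have := congrArg f key
  rw [map_add, map_add, map_zsmul, map_zsmul, map_mul, map_mul, map_add, map_intCast, map_one,
    map_ofNat, map_ofNat] at this
  rw [this]
  exact add_mem (add_mem (zsmul_mem hτ₀N _) (hnN _)) (zsmul_mem twelve_mem_relKer _)

end


/-- Positive definite integral binary quadratic forms of discriminant `-15` represent `1` or `2`. -/
lemma exists_form_eq_one_or_two {a b c : ℤ} (ha : 0 < a) (h : b ^ 2 - 4 * a * c = -15) :
    ∃ x y : ℤ, a * x ^ 2 + b * x * y + c * y ^ 2 = 1 ∨ a * x ^ 2 + b * x * y + c * y ^ 2 = 2 := by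
  induction hn : a.toNat using Nat.strong_induction_on generalizing a b c with
  | _ n ih =>
  by_cases ha3 : a < 3
  · exact ⟨1, 0, by omega⟩
  obtain ⟨k, hk1, hk2⟩ : ∃ k : ℤ, b - 2 * a * k ≤ a ∧ -a ≤ b - 2 * a * k := by
    refine ⟨(b + a) / (2 * a), ?_, ?_⟩
    · have := Int.emod_add_mul_ediv (b + a) (2 * a)
      have := Int.emod_lt_of_pos (b + a) (show 0 < 2 * a by omega)
      linarith
    · have := Int.emod_add_mul_ediv (b + a) (2 * a)
      have := Int.emod_nonneg (b + a) (show 2 * a ≠ 0 by omega)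
      linarith
  obtain ⟨b', hb'⟩ : ∃ b', b' = b - 2 * a * k := ⟨_, rfl⟩
  obtain ⟨c', hc'⟩ : ∃ c', c' = a * k ^ 2 - b * k + c := ⟨_, rfl⟩
  have hd : b' ^ 2 - 4 * a * c' = -15 := by rw [hb', hc', ← h]; ring
  rw [← hb'] at hk1 hk2
  have hb2 : b' ^ 2 ≤ a ^ 2 := by nlinarith
  have hc0 : 0 < c' := by
    by_contra! hc
    nlinarith [sq_nonneg b']
  have hca : c' < a := by
    by_contra! hc
    nlinarith
  obtain ⟨x, y, hxy⟩ := ih c'.toNat (by omega) (a := c') (b := b') (c := a) hc0 (by linarith) rfl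
  refine ⟨y - k * x, x, ?_⟩
  have : a * (y - k * x) ^ 2 + b * (y - k * x) * x + c * x ^ 2 =
      c' * x ^ 2 + b' * x * y + a * y ^ 2 := by rw [hb', hc']; ring
  rwa [this]

lemma exists_nm_eq {r c : ℤ} (hr : 0 < r) (h : r ∣ c ^ 2 - c + 4) :
    ∃ x y : ℤ, nm (x * r + y * (w - c)) = r ∨ nm (x * r + y * (w - c)) = 2 * r := by
  obtain ⟨d, hd⟩ := h
  obtain ⟨x, y, hxy⟩ := exists_form_eq_one_or_two (b := 1 - 2 * c) (c := d) hr
    (by linear_combination 4 * hd)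
  refine ⟨x, y, ?_⟩
  have : nm ((x : QO) * r + y * (w - c)) = r * (r * x ^ 2 + (1 - 2 * c) * x * y + d * y ^ 2) := by
    rw [nm_def]; simp; linear_combination y ^ 2 * hd
  rw [this]
  rcases hxy with hxy | hxy <;> rw [hxy]
  · left; ring
  · right; ring

lemma isCoprime_im {r : ℤ} (hr : Prime r) {d : QO} (hd : ¬ r ^ 2 ∣ nm d) (hrd : r ∣ nm d) :
    IsCoprime r d.im := by
  rw [hr.coprime_iff_not_dvd]
  rintro ⟨y, hy⟩
  apply hd
  have h1 : r ∣ d.re := by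
    apply hr.dvd_of_dvd_pow (n := 2)
    have : d.re ^ 2 = nm d - r * (y * (d.re + 4 * d.im)) := by
      rw [nm_def]; linear_combination -(d.re + 4 * d.im) * hy
    rw [this]
    exact dvd_sub hrd (dvd_mul_right _ _)
  obtain ⟨x, hx⟩ := h1
  exact ⟨x ^ 2 + x * y + 4 * y ^ 2, by rw [nm_def, hx, hy]; ring⟩

lemma exists_w_sub_intCast_mem {I : Ideal QO} {r : ℤ} (hr : (r : QO) ∈ I) {d : QO} (hd : d ∈ I)
    (h : IsCoprime r d.im) : ∃ t : ℤ, w - t ∈ I := by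
  obtain ⟨u, v, huv⟩ := h
  refine ⟨-(v * d.re), ?_⟩
  have : w - ((-(v * d.re) : ℤ) : QO) = v * d + u * w * r := by
    have h1 := eq_add d
    have h2 : (u : QO) * r + v * d.im = 1 := by exact_mod_cast huv
    push_cast
    linear_combination -w * h2 - v * h1
  rw [this]
  exact add_mem (I.mul_mem_left _ hd) (I.mul_mem_left _ hr)

lemma le_of_w_sub_mem {p I : Ideal QO} {r t : ℤ} (hp : ∀ n : ℤ, (n : QO) ∈ p → r ∣ n)
    (htp : w - t ∈ p) (hr : (r : QO) ∈ I) (ht : w - t ∈ I) : p ≤ I := by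
  intro x hx
  have h1 : x = ((x.re + x.im * t : ℤ) : QO) + x.im * (w - t) := by
    conv_lhs => rw [eq_add x]
    push_cast; ring
  have h2 : ((x.re + x.im * t : ℤ) : QO) ∈ p := by
    have : ((x.re + x.im * t : ℤ) : QO) = x - x.im * (w - t) := by linear_combination -h1
    rw [this]
    exact sub_mem hx (p.mul_mem_left _ htp)
  obtain ⟨k, hk⟩ := hp _ h2
  rw [h1, hk]
  push_cast
  exact add_mem (I.mul_mem_right _ hr) (I.mul_mem_left _ ht)

lemma jacobiSym_natCast_natAbs {R : ℤ} (hR : R % 4 = 1) {ρ : ℕ} (hρ : ρ % 4 = 3) :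
    jacobiSym R ρ = jacobiSym ρ R.natAbs := by
  have hρo : Odd ρ := Nat.odd_iff.2 (by omega)
  rcases Int.natAbs_eq R with h | h
  · rw [h, Int.natAbs_natCast]
    exact jacobiSym.quadratic_reciprocity_one_mod_four (by omega) hρo
  · have h3 : R.natAbs % 4 = 3 := by omega
    conv_lhs => rw [h]
    rw [jacobiSym.neg _ hρo, jacobiSym.quadratic_reciprocity_three_mod_four h3 hρ,
      ZMod.χ₄_nat_three_mod_four hρ]
    ring

lemma exists_prime_jacobiSym_eq_neg_one {R : ℤ} (hR : R % 4 = 1) (hp : R.natAbs.Prime)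
    (h2 : R.natAbs ≠ 2) (h3 : R.natAbs ≠ 3) (h5 : R.natAbs ≠ 5) :
    ∃ ρ : ℕ, ρ.Prime ∧ ρ % 4 = 3 ∧ ρ % 15 = 1 ∧ jacobiSym R ρ = -1 := by
  obtain ⟨r, hr⟩ : ∃ r, r = R.natAbs := ⟨_, rfl⟩
  rw [← hr] at hp h2 h3 h5
  have : Fact r.Prime := ⟨hp⟩
  obtain ⟨g, hg⟩ := FiniteField.exists_nonsquare (F := ZMod r) (by rwa [ZMod.ringChar_zmod_n])
  have hcop : Nat.Coprime r 60 := by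
    rw [hp.coprime_iff_not_dvd]
    intro h
    have : r ∣ 2 * 2 * 3 * 5 := h
    simp only [hp.dvd_mul, Nat.prime_dvd_prime_iff_eq hp Nat.prime_two,
      Nat.prime_dvd_prime_iff_eq hp Nat.prime_three,
      Nat.prime_dvd_prime_iff_eq hp Nat.prime_five] at this
    tauto
  obtain ⟨x, hx1, hx2⟩ := Nat.chineseRemainder hcop g.val 31
  have hg0 : g ≠ 0 := by rintro rfl; exact hg (IsSquare.zero)
  have hxr : (x : ZMod r) = g := by
    rw [(ZMod.natCast_eq_natCast_iff _ _ _).2 hx1, ZMod.natCast_zmod_val]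
  have hxcop : Nat.Coprime x (r * 60) := by
    apply Nat.Coprime.mul_right
    · rw [← ZMod.isUnit_iff_coprime, hxr]; exact hg0.isUnit
    · rw [Nat.Coprime, hx2.gcd_eq]; norm_num
  have : NeZero (r * 60) := ⟨by have := hp.pos; omega⟩
  obtain ⟨ρ, -, hρ, hρx⟩ := Nat.forall_exists_prime_gt_and_eq_mod
    ((ZMod.isUnit_iff_coprime x (r * 60)).2 hxcop) 0
  rw [ZMod.natCast_eq_natCast_iff] at hρx
  have h60 : ρ % 60 = 31 := (hρx.of_mul_left r).trans hx2
  have hρr : ρ ≡ x [MOD r] := hρx.of_mul_right 60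
  refine ⟨ρ, hρ, by omega, by omega, ?_⟩
  rw [jacobiSym_natCast_natAbs hR (by omega), ← hr, ← jacobiSym.legendreSym.to_jacobiSym,
    legendreSym.eq_neg_one_iff]
  have : ((ρ : ℤ) : ZMod r) = g := by
    rw [Int.cast_natCast, (ZMod.natCast_eq_natCast_iff _ _ _).2 hρr, hxr]
  rwa [this]

lemma exists_nm_eq_prime {ρ : ℕ} (hρ : ρ.Prime) (h4 : ρ % 4 = 3) (h15 : ρ % 15 = 1) :
    ∃ d : QO, nm d = ρ := by
  have : Fact ρ.Prime := ⟨hρ⟩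
  have hj : legendreSym ρ (-15) = 1 := by
    rw [jacobiSym.legendreSym.to_jacobiSym, jacobiSym_natCast_natAbs (by norm_num) h4]
    have : (-15 : ℤ).natAbs = 15 := rfl
    rw [this, jacobiSym.mod_left, show ((ρ : ℤ) % (15 : ℕ)) = 1 by omega, jacobiSym.one_left]
  have h0 : (((-15 : ℤ)) : ZMod ρ) ≠ 0 := by
    intro h
    rw [(legendreSym.eq_zero_iff ρ (-15)).2 h] at hj
    norm_num at hj
  obtain ⟨y, hy⟩ := (legendreSym.eq_one_iff ρ h0).1 hj
  have h2 : (2 : ZMod ρ) ≠ 0 := by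
    intro h
    have : ((2 : ℕ) : ZMod ρ) = 0 := by exact_mod_cast h
    rw [ZMod.natCast_eq_zero_iff] at this
    have := Nat.le_of_dvd (by norm_num) this
    have := hρ.two_le
    omega
  obtain ⟨t, ht⟩ := ZMod.intCast_surjective ((1 + y) / 2)
  have hdvd : (ρ : ℤ) ∣ t ^ 2 - t + 4 := by
    rw [← ZMod.intCast_zmod_eq_zero_iff_dvd]
    push_cast at hy ⊢
    rw [ht]
    field_simp
    linear_combination -hy
  obtain ⟨x, y, h | h⟩ := exists_nm_eq (by exact_mod_cast hρ.pos) hdvd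
  · exact ⟨_, h⟩
  · exfalso
    rw [nm_def] at h
    obtain ⟨a, ha⟩ : ∃ a, a = ((x : QO) * ((ρ : ℤ) : QO) + y * (w - t)).re := ⟨_, rfl⟩
    obtain ⟨b, hb⟩ : ∃ a, a = ((x : QO) * ((ρ : ℤ) : QO) + y * (w - t)).im := ⟨_, rfl⟩
    rw [← ha, ← hb] at h
    have h3 : a ^ 2 + a * b + 4 * b ^ 2 = (a - b) ^ 2 + 3 * (a * b + b ^ 2) := by ring
    rw [h3] at h
    have h4 : (a - b) ^ 2 % 3 = 2 := by omega
    rcases (show (a - b) % 3 = 0 ∨ (a - b) % 3 = 1 ∨ (a - b) % 3 = 2 by omega) with h | h | h <;>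
      simp [pow_two, Int.mul_emod, h] at h4


section

variable {A : Type*} [CommRing A] {f : QO →+* A} {P : QO}

/-- Some element congruent to `ω` or `ω + 1` modulo `2` becomes a relation after multiplication
by `4`. -/
def HasFourMul (f : QO →+* A) : Prop :=
  ∃ e : A, 4 * e ∈ relKer A ∧ (2 ∣ e - f w ∨ 2 ∣ e - (f w + 1))

lemma IsSLocalization.four_mul_mem (hf : IsSLocalization f P) (h : HasFourMul f) :
    4 * (f w + 1) ∈ relKer A := by
  have h8 := hf.eight_mul_mem
  have h12 : (12 : A) ∈ relKer A := twelve_mem_relKer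
  have h24 : ∀ a : A, 24 * a ∈ relKer A := by
    intro a
    obtain ⟨n, hn, -, hnN⟩ := hf.exists_int_mul_mem
    obtain ⟨x, b, hx⟩ := hf.exists_eq_add_mul hn.ne' a
    have e : 24 * a = (2 * (x.re - x.im)) • (12 : A) + (3 * x.im) • (8 * (f w + 1)) +
        n * (24 * b) := by
      have hxA : f x = x.re + x.im * f w := by
        conv_lhs => rw [eq_add x]
        simp
      simp only [zsmul_eq_mul]
      push_cast
      linear_combination 24 * hx + 24 * hxA
    rw [e]
    exact add_mem (add_mem (zsmul_mem h12 _) (zsmul_mem h8 _)) (hnN _)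
  obtain ⟨e, he, h2⟩ := h
  have h12e : 12 * e ∈ relKer A := by
    have := nsmul_mem he 3
    convert this using 1
    rw [nsmul_eq_mul]; push_cast; ring
  have h12w : 12 * (f w + 1) ∈ relKer A := by
    obtain ⟨a, ha⟩ | ⟨a, ha⟩ := h2
    · have := add_mem (sub_mem h12e (h24 a)) h12
      convert this using 1
      linear_combination -12 * ha
    · have := sub_mem h12e (h24 a)
      convert this using 1
      linear_combination -12 * ha
  have := sub_mem h12w h8
  convert this using 1
  ring

lemma hasFourMul_of_sq_eq {t t' v : QO} {k l : ℤ} (ht : t + t' = 1) (htt : t * t' = 4)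
    (htw : t = w ∨ t = w') (hk : Odd k) (hl : Odd l)
    (hv : v = k ^ 2 * t' + 4 * k * l + l ^ 2 * t) (hu : IsUnit (f v)) : HasFourMul f := by
  obtain ⟨k₁, hk₁⟩ := Int.eight_dvd_sq_sub_one_of_odd hk
  obtain ⟨l₁, hl₁⟩ := Int.eight_dvd_sq_sub_one_of_odd hl
  obtain ⟨m, hm⟩ := hk.mul hl
  obtain ⟨l', hl'⟩ := id hl
  obtain ⟨z, hz⟩ : ∃ z : QO, z = k₁ * t' + m + l₁ * t := ⟨_, rfl⟩
  obtain ⟨β, hβ⟩ : ∃ β : QO, β = 2 * k + l * t := ⟨_, rfl⟩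
  have hkq : (k : QO) ^ 2 = 1 + 8 * k₁ := by
    have : (k : QO) ^ 2 - 1 = 8 * k₁ := by exact_mod_cast hk₁
    linear_combination this
  have hlq : (l : QO) ^ 2 = 1 + 8 * l₁ := by
    have : (l : QO) ^ 2 - 1 = 8 * l₁ := by exact_mod_cast hl₁
    linear_combination this
  have hmq : (k : QO) * l = 2 * m + 1 := by exact_mod_cast hm
  have hlq' : (l : QO) = 2 * l' + 1 := by exact_mod_cast hl'
  have hvz : v = 5 + 8 * z := by
    rw [hv, hz]
    linear_combination t' * hkq + t * hlq + 4 * hmq + ht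
  have hβ2 : β ^ 2 = t * v := by
    rw [hβ, hv]
    linear_combination -k ^ 2 * htt
  obtain ⟨u, hu⟩ := hu.exists_right_inv
  have hvzA : f v = 5 + 8 * f z := by
    rw [hvz, map_add, map_mul, map_ofNat, map_ofNat]
  have hβ2A : f β ^ 2 = f t * f v := by rw [← map_pow, hβ2, map_mul]
  have httA : f t * f t' = 4 := by rw [← map_mul, htt, map_ofNat]
  have key := mem_relKer_of_mul_eq (x := f t' * (1 + 2 * f z) * f β * u) (y := f β) hu (by
    rw [hvzA] at hβ2A hu ⊢
    linear_combination f t' * (1 + 2 * f z) * u * hβ2A +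
      f t' * (1 + 2 * f z) * f t * hu + (1 + 2 * f z) * httA)
  refine ⟨(1 + 2 * f z) * (f t' * (1 + 2 * f z) * f β * u - f β - 3 - 8 * f z) * u, ?_, ?_⟩
  · convert key using 1
    rw [hvzA]; ring
  · have hβA : f β = f t + 2 * f (k + l' * t) := by
      rw [← map_ofNat f 2, ← map_mul, ← map_add, hβ]
      congr 1
      linear_combination t * hlq'
    have hw' : f w' = 1 - f w := by
      rw [← map_one f, ← map_sub]; congr 1
    have main : (2 : A) ∣ (1 + 2 * f z) * (f t' * (1 + 2 * f z) * f β * u - f β - 3 - 8 * f z) * u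
        - (f t + 1) := by
      rw [← Ideal.mem_span_singleton, ← Ideal.Quotient.eq_zero_iff_mem]
      obtain ⟨g, hg⟩ : ∃ g, g = Ideal.Quotient.mk (Ideal.span {(2 : A)}) := ⟨_, rfl⟩
      rw [← hg]
      have h2 : (2 : A ⧸ Ideal.span {(2 : A)}) = 0 := by
        rw [← map_ofNat g 2, hg]
        exact Ideal.Quotient.eq_zero_iff_mem.2 (Ideal.mem_span_singleton_self _)
      have h1 := congrArg g hu
      have h3 := congrArg g hβA
      have h4 := congrArg g httA
      rw [hvzA] at h1
      simp only [map_mul, map_add, map_sub, map_one, map_ofNat] at h1 h3 h4 ⊢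
      have h8 : (8 : A ⧸ Ideal.span {(2 : A)}) = 0 := by linear_combination 4 * h2
      have h1' : g u = 1 := by linear_combination h1 - g u * (2 * h2) - g u * g (f z) * h8
      rw [h1', h3, h2, h8]
      linear_combination h4 + (-g (f t)) * h2
    rcases htw with h | h
    · right; rwa [h] at main
    · left
      rw [h, hw'] at main
      have := dvd_add main (dvd_mul_right 2 (1 - f w))
      convert this using 1; ring

lemma hasFourMul_of_im {π : QO} {a b : ℤ} (hπ : π = (2 * a - 1 : ℤ) + 2 * b * w) (hb : Odd b)
    (hu : IsUnit (f π)) : HasFourMul f := by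
  obtain ⟨v, hv⟩ := hu.exists_right_inv
  have key := mem_relKer_of_mul_eq (v := -f π) (v' := -v) (x := 1 + f π) (y := -1)
    (by linear_combination hv) (by ring)
  obtain ⟨b', hb'⟩ := hb
  have hπA : f π = 2 * a - 1 + 2 * b * f w := by
    rw [hπ]; simp [map_ofNat f]
  have hbA : (b : A) = 2 * b' + 1 := by rw [hb']; push_cast; rfl
  refine ⟨(a + b * f w) * (f π + 2) * v, ?_, ?_⟩
  · convert key using 1
    linear_combination (-2 * (f π + 2) * v) * hπA
  · have h : (a + b * f w) * (f π + 2) * v = a + b * f w + 2 * ((a + b * f w) * v) := by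
      linear_combination (a + b * f w) * hv
    obtain ⟨a', ha' | ha'⟩ := Int.even_or_odd' a
    · left
      have haA : (a : A) = 2 * a' := by rw [ha']; push_cast; rfl
      exact ⟨a' + b' * f w + (a + b * f w) * v, by rw [h]; linear_combination haA + f w * hbA⟩
    · right
      have haA : (a : A) = 2 * a' + 1 := by rw [ha']; push_cast; rfl
      exact ⟨a' + b' * f w + (a + b * f w) * v, by rw [h]; linear_combination haA + f w * hbA⟩

lemma hasFourMul_of_dvd {π d : QO} {k : ℕ} (hπ : 4 ∣ π - 1) (hd : nm d % 4 = 3)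
    (hdvd : d ∣ π ^ k + 1) (hu : IsUnit (f π)) : HasFourMul f := by
  obtain ⟨z, hz⟩ : 4 ∣ π ^ k - 1 := hπ.trans (by simpa using sub_dvd_pow_sub_pow π 1 k)
  have hre : d.re % 2 = 1 ∧ d.im % 4 = 2 := by
    rw [nm_def] at hd
    have h1 : (d.re * (d.re + d.im)) % 4 = 3 := by
      have : d.re * (d.re + d.im) = d.re ^ 2 + d.re * d.im := by ring
      omega
    have h4 : d.re % 4 = 0 ∨ d.re % 4 = 1 ∨ d.re % 4 = 2 ∨ d.re % 4 = 3 := by omega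
    have h5 : d.im % 4 = 0 ∨ d.im % 4 = 1 ∨ d.im % 4 = 2 ∨ d.im % 4 = 3 := by omega
    rcases h4 with h4 | h4 | h4 | h4 <;> rcases h5 with h5 | h5 | h5 | h5 <;>
      simp [Int.mul_emod, Int.add_emod, h4, h5] at h1 <;> omega
  obtain ⟨a, ha⟩ : ∃ a, d.re = 3 - 2 * a := ⟨(3 - d.re) / 2, by omega⟩
  obtain ⟨b, hb⟩ : ∃ b, d.im = 2 * (2 * b + 1) := ⟨d.im / 4, by omega⟩
  have hd' : d = 3 - 2 * (a - (2 * b + 1) * w) := by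
    conv_lhs => rw [eq_add d, ha, hb]
    push_cast; ring
  obtain ⟨x, hx⟩ : ∃ x, 1 + 2 * z = d * x := by
    obtain ⟨y, hy⟩ := hdvd
    obtain ⟨ρ, hρ⟩ : ∃ ρ, nm d = 2 * ρ + 1 := ⟨nm d / 2, by omega⟩
    have hρ' : d * star d = 2 * ρ + 1 := by rw [self_mul_star, hρ]; push_cast; rfl
    have h0 : (2 : QO) ≠ 0 := by intro h; simpa using congrArg QuadraticAlgebra.re h
    have h1 : d * y = 2 * (1 + 2 * z) := by linear_combination -hy + hz
    have h2 : y = 2 * (star d * (1 + 2 * z) - ρ * y) := by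
      linear_combination star d * h1 - y * hρ'
    refine ⟨star d * (1 + 2 * z) - ρ * y, mul_left_cancel₀ h0 ?_⟩
    linear_combination -h1 + d * h2
  have hxodd : x = 1 + 2 * (z - x * (1 - a + (2 * b + 1) * w)) := by
    linear_combination -hx - x * hd'
  have hvz : -f (π ^ k) = -(1 + 4 * f z) := by
    have := congrArg f hz
    rw [map_sub, map_mul, map_one, map_ofNat] at this
    linear_combination -this
  obtain ⟨v', hv'⟩ := ((hu.pow k).neg).exists_right_inv
  rw [← map_pow] at hv'
  have hxA : 1 + 2 * f z = f d * f x := by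
    have := congrArg f hx
    rwa [map_add, map_mul, map_mul, map_one, map_ofNat] at this
  have hdA : f d = 3 - 2 * (a - (2 * b + 1) * f w) := by
    rw [hd']; simp [map_ofNat f]
  have hxoddA := congrArg f hxodd
  simp only [map_add, map_mul, map_sub, map_one, map_ofNat, map_intCast] at hxoddA
  have key := mem_relKer_of_mul_eq (x := -2 * f x) (y := f d) hv' (by
    linear_combination 2 * hxA - hvz)
  refine ⟨-(1 + 2 * f z) * (-f x + (a - (2 * b + 1) * f w) + 2 * f z) * v', ?_, ?_⟩
  · convert key using 1
    rw [hvz, hdA]; ring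
  · have hv1 : v' = 1 - 2 * (1 + 2 * f z * v') := by
      linear_combination -hv' + v' * hvz
    obtain ⟨Y, hY⟩ : ∃ Y, Y = f z - f x * (1 - a + (2 * b + 1) * f w) := ⟨_, rfl⟩
    obtain ⟨V, hV⟩ : ∃ V, V = 1 + 2 * f z * v' := ⟨_, rfl⟩
    rw [← hY] at hxoddA
    rw [← hV] at hv1
    obtain ⟨E, hE⟩ : ∃ E, E = -f x + (a - (2 * b + 1) * f w) + 2 * f z := ⟨_, rfl⟩
    have h1 : (2 : A) ∣ -(1 + 2 * f z) * E * v' - E := by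
      refine ⟨-E + E * V - f z * E * v', ?_⟩
      linear_combination (-E) * hv1
    have h2 : E = -1 - 2 * Y + a - (2 * b + 1) * f w + 2 * f z := by
      rw [hE, hxoddA]; ring
    rw [← hE]
    obtain ⟨a', ha' | ha'⟩ := Int.even_or_odd' a
    · right
      have haA : (a : A) = 2 * a' := by rw [ha']; push_cast; rfl
      have h3 : (2 : A) ∣ E - (f w + 1) :=
        ⟨-1 - Y + a' - (b + 1) * f w + f z, by rw [h2]; linear_combination haA⟩
      have := dvd_add h1 h3
      convert this using 1; ring
    · left
      have haA : (a : A) = 2 * a' + 1 := by rw [ha']; push_cast; rfl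
      have h3 : (2 : A) ∣ E - f w :=
        ⟨-Y + a' - (b + 1) * f w + f z, by rw [h2]; linear_combination haA⟩
      have := dvd_add h1 h3
      convert this using 1; ring

end


lemma intCast_dvd_pow_add_one {ρ : ℕ} (hρ : ρ.Prime) {x : ℤ} (h : jacobiSym x ρ = -1) :
    (ρ : ℤ) ∣ x ^ (ρ / 2) + 1 := by
  have : Fact ρ.Prime := ⟨hρ⟩
  have h1 := legendreSym.eq_pow ρ x
  rw [jacobiSym.legendreSym.to_jacobiSym, h] at h1
  rw [← ZMod.intCast_zmod_eq_zero_iff_dvd]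
  push_cast at h1 ⊢
  rw [← h1]; ring

lemma exists_dvd_pow_add_one {π : QO} {R : ℤ} (hR4 : R % 4 = 1) (hR : R.natAbs.Prime)
    (h2 : R.natAbs ≠ 2) (h3 : R.natAbs ≠ 3) (h5 : R.natAbs ≠ 5)
    (hπ : nm π = R ∨ π = R) : ∃ (d : QO) (k : ℕ), nm d % 4 = 3 ∧ d ∣ π ^ k + 1 := by
  obtain ⟨ρ, hρ, hρ4, hρ15, hj⟩ := exists_prime_jacobiSym_eq_neg_one hR4 hR h2 h3 h5
  obtain ⟨d, hd⟩ := exists_nm_eq_prime hρ hρ4 hρ15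
  have hd4 : nm d % 4 = 3 := by omega
  have hdρ : d ∣ ((ρ : ℤ) : QO) := by rw [← hd]; exact dvd_nm d
  rcases hπ with hπ | hπ
  swap
  · refine ⟨d, ρ / 2, hd4, hdρ.trans ?_⟩
    have := intCast_dvd_intCast.2 (intCast_dvd_pow_add_one hρ hj)
    rw [hπ]
    exact_mod_cast this
  have hρp : Prime (ρ : ℤ) := Nat.prime_iff_prime_int.1 hρ
  have hsq : ¬ (ρ : ℤ) ^ 2 ∣ nm d := by
    rw [hd]
    rintro ⟨c, hc⟩
    have h0 : (ρ : ℤ) ≠ 0 := hρp.ne_zero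
    have : (ρ : ℤ) * c = 1 := mul_left_cancel₀ h0 (by linear_combination -hc)
    exact hρp.not_isUnit (IsUnit.of_mul_eq_one _ this)
  obtain ⟨t, ht⟩ := exists_w_sub_intCast_mem (I := Ideal.span {d}) (r := ρ)
    (Ideal.mem_span_singleton.2 hdρ) (Ideal.mem_span_singleton_self d)
    (isCoprime_im hρp hsq (by rw [hd]))
  rw [Ideal.mem_span_singleton] at ht
  have key : ∀ x : QO, d ∣ x - (x.re + x.im * t : ℤ) := by
    intro x
    have : x - (x.re + x.im * t : ℤ) = x.im * (w - t) := by
      conv_lhs => rw [eq_add x]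
      simp
      ring
    rw [this]
    exact ht.mul_left _
  have hpow : ∀ x : QO, jacobiSym (x.re + x.im * t) ρ = -1 → d ∣ x ^ (ρ / 2) + 1 := by
    intro x hx
    have h1 := intCast_dvd_intCast.2 (intCast_dvd_pow_add_one hρ hx)
    have h2 := (key x).trans (sub_dvd_pow_sub_pow x _ (ρ / 2))
    have := dvd_add h2 (hdρ.trans h1)
    convert this using 1
    push_cast
    ring
  have hmul : (ρ : ℤ) ∣ (π.re + π.im * t) * ((star π).re + (star π).im * t) - R := by
    have h1 : d ∣ (((π.re + π.im * t) * ((star π).re + (star π).im * t) - R : ℤ) : QO) := by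
      have e : (((π.re + π.im * t) * ((star π).re + (star π).im * t) - R : ℤ) : QO) =
          -(star π) * (π - (π.re + π.im * t : ℤ)) -
            (π.re + π.im * t : ℤ) * (star π - ((star π).re + (star π).im * t : ℤ)) := by
        have := self_mul_star π
        rw [hπ] at this
        rw [Int.cast_sub, Int.cast_mul]
        linear_combination this
      rw [e]
      exact dvd_sub ((key π).mul_left _) ((key (star π)).mul_left _)
    obtain ⟨y, hy⟩ := h1
    have h2 := congrArg nm hy
    rw [nm_mul, hd] at h2
    apply hρp.dvd_of_dvd_pow (n := 2)
    refine ⟨nm y, ?_⟩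
    rw [← h2, nm_def]
    simp
  have hj2 : jacobiSym (π.re + π.im * t) ρ * jacobiSym ((star π).re + (star π).im * t) ρ = -1 := by
    rw [← jacobiSym.mul_left, ← hj]
    exact (jacobiSym.mod_left' (Int.modEq_iff_dvd.2 hmul)).symm
  rcases jacobiSym.trichotomy (π.re + π.im * t) ρ with h | h | h
  · rw [h] at hj2; norm_num at hj2
  · rw [h, one_mul] at hj2
    refine ⟨star d, ρ / 2, by rwa [nm_star], ?_⟩
    obtain ⟨y, hy⟩ := hpow _ hj2
    refine ⟨star y, ?_⟩
    have := congrArg star hy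
    rw [star_mul, star_add, star_pow, star_star, star_one] at this
    rw [this, mul_comm]
  · exact ⟨d, ρ / 2, hd4, hpow _ h⟩

section

variable {A : Type*} [CommRing A] {f : QO →+* A} {P : QO}

lemma hasFourMul_of_four_dvd {π : QO} (hu : IsUnit (f π)) (hπ4 : 4 ∣ π - 1) {R : ℤ}
    (hR4 : R % 4 = 1) (hR : R.natAbs.Prime) (h2 : R.natAbs ≠ 2) (h3 : R.natAbs ≠ 3)
    (h5 : R.natAbs ≠ 5) (hπ : nm π = R ∨ π = R) : HasFourMul f := by
  obtain ⟨d, k, hd, hk⟩ := exists_dvd_pow_add_one hR4 hR h2 h3 h5 hπ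
  exact hasFourMul_of_dvd hπ4 hd hk hu

lemma hasFourMul_of_unit {π : QO} (hu : IsUnit (f π)) {r : ℕ} (hr : r.Prime) (h2 : r ≠ 2)
    (h3 : r ≠ 3) (h5 : r ≠ 5) (hπ : nm π = r ∨ π = (r : ℤ)) : HasFourMul f := by
  have hr2 : r % 2 = 1 := Nat.odd_iff.1 (hr.odd_of_ne_two h2)
  rcases hπ with hπ | hπ
  · have hπ' := hπ
    rw [nm_def] at hπ'
    have h1 : (π.re * (π.re + π.im)) % 2 = 1 := by
      have : π.re * (π.re + π.im) = π.re ^ 2 + π.re * π.im := by ring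
      omega
    have ha : π.re % 2 = 1 ∧ π.im % 2 = 0 := by
      rcases Int.emod_two_eq_zero_or_one π.re with h | h <;>
      rcases Int.emod_two_eq_zero_or_one π.im with h' | h' <;>
        simp [Int.mul_emod, Int.add_emod, h, h'] at h1 <;> omega
    obtain ⟨ha, hb⟩ := ha
    obtain ⟨b, hb⟩ : ∃ b, π.im = 2 * b := ⟨π.im / 2, by omega⟩
    rcases Int.even_or_odd' b with ⟨c, hc | hc⟩
    swap
    · obtain ⟨a, ha⟩ : ∃ a, π.re = 2 * a - 1 := ⟨(π.re + 1) / 2, by omega⟩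
      refine hasFourMul_of_im (π := π) (a := a) (b := b) ?_ ⟨c, hc⟩ hu
      conv_lhs => rw [eq_add π, ha, hb]
      push_cast; ring
    rcases (show π.re % 4 = 1 ∨ π.re % 4 = 3 by omega) with h4 | h4
    · obtain ⟨a, ha⟩ : ∃ a, π.re = 4 * a + 1 := ⟨π.re / 4, by omega⟩
      refine hasFourMul_of_four_dvd hu ⟨a + c * w, ?_⟩ (R := r) ?_ hr h2 h3 h5 (Or.inl hπ)
      · conv_lhs => rw [eq_add π, ha, hb, hc]
        push_cast; ring
      · rw [← hπ', ha, hb, hc]; ring_nf; omega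
    · obtain ⟨a, ha⟩ : ∃ a, π.re = 4 * a - 1 := ⟨(π.re + 1) / 4, by omega⟩
      refine hasFourMul_of_four_dvd (π := -π) (by rw [map_neg]; exact hu.neg) ⟨-a - c * w, ?_⟩
        (R := r) ?_ hr h2 h3 h5 (Or.inl ?_)
      · conv_lhs => rw [eq_add π, ha, hb, hc]
        push_cast; ring
      · rw [← hπ', ha, hb, hc]; ring_nf; omega
      · rw [← hπ, nm_def, nm_def]; simp
  · rcases (show (r : ℤ) % 4 = 1 ∨ (r : ℤ) % 4 = 3 by omega) with h4 | h4
    · obtain ⟨a, ha⟩ : ∃ a, (r : ℤ) = 4 * a + 1 := ⟨(r : ℤ) / 4, by omega⟩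
      refine hasFourMul_of_four_dvd hu ⟨a, ?_⟩ (R := r) h4 hr h2 h3 h5 (Or.inr hπ)
      rw [hπ, ha]; push_cast; ring
    · obtain ⟨a, ha⟩ : ∃ a, (r : ℤ) = 4 * a - 1 := ⟨((r : ℤ) + 1) / 4, by omega⟩
      refine hasFourMul_of_four_dvd (π := -π) (by rw [map_neg]; exact hu.neg) ⟨-a, ?_⟩
        (R := -r) (by omega) ?_ ?_ ?_ ?_ (Or.inr (by rw [hπ]; push_cast; rfl))
      · rw [hπ, ha]; push_cast; ring
      all_goals simpa

end


lemma exists_prime_forall_intCast_mem {p : Ideal QO} (hp : p.IsPrime) (hp0 : p ≠ ⊥) :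
    ∃ r : ℕ, r.Prime ∧ ∀ n : ℤ, (n : QO) ∈ p ↔ (r : ℤ) ∣ n := by
  obtain ⟨x, hx, hx0⟩ := Submodule.exists_mem_ne_zero_of_ne_bot hp0
  have hcp : (p.comap (Int.castRingHom QO)).IsPrime := Ideal.comap_isPrime _ _
  obtain ⟨g, hg⟩ := (IsPrincipalIdealRing.principal (p.comap (Int.castRingHom QO))).principal
  have hmem : ∀ n : ℤ, (n : QO) ∈ p ↔ g ∣ n := by
    intro n
    have : n ∈ p.comap (Int.castRingHom QO) ↔ g ∣ n := by
      rw [hg]; exact Ideal.mem_span_singleton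
    simpa using this
  have hg0 : g ≠ 0 := by
    rintro rfl
    have h1 : ((nm x : ℤ) : QO) ∈ p := by
      rw [← self_mul_star]; exact p.mul_mem_right _ hx
    rw [hmem, zero_dvd_iff] at h1
    exact (nm_pos hx0).ne' h1
  have hgp : Prime g := by
    rw [← Ideal.span_singleton_prime hg0]
    rwa [hg] at hcp
  refine ⟨g.natAbs, Int.prime_iff_natAbs_prime.1 hgp, fun n => ?_⟩
  rw [hmem, Int.natAbs_dvd]

lemma nm_ne_three (x : QO) : nm x ≠ 3 := by
  intro h
  have h1 := four_nm x
  rw [h] at h1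
  have : x.im = 0 := by nlinarith [sq_nonneg (2 * x.re + x.im), Int.le_self_sq x.im]
  rw [this] at h1
  have h2 : x.re ^ 2 = 3 := by linarith
  have h3 : x.re < 2 := by nlinarith
  have h4 : -2 < x.re := by nlinarith
  interval_cases x.re <;> omega

lemma nm_ne_five (x : QO) : nm x ≠ 5 := by
  intro h
  have h1 := four_nm x
  rw [h] at h1
  have h2 : x.im < 2 := by nlinarith [sq_nonneg (2 * x.re + x.im)]
  have h3 : -2 < x.im := by nlinarith [sq_nonneg (2 * x.re + x.im)]
  obtain ⟨X, hX⟩ : ∃ X, X = 2 * x.re + x.im := ⟨_, rfl⟩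
  rw [← hX] at h1
  have h4 : X < 5 := by nlinarith [sq_nonneg x.im]
  have h5 : -5 < X := by nlinarith [sq_nonneg x.im]
  interval_cases x.im <;> interval_cases X <;> omega

section

variable {A : Type*} [CommRing A] {f : QO →+* A}

lemma hasFourMul_of_nm_eq {t t' : QO} {k l r : ℤ} (hr : r % 2 = 1) (ht : t + t' = 1)
    (htt : t * t' = 4) (htw : t = w ∨ t = w') (hkl : 2 * k ^ 2 + k * l + 2 * l ^ 2 = r)
    (hnm : nm (2 * k + l * t) = 2 * r)
    (hu : ∀ x : QO, x ≠ 0 → (∀ I : Ideal QO, I.IsPrime → x ∈ I → (r : QO) ∈ I ∧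
      2 * k + l * t ∈ I) → IsUnit (f x)) : HasFourMul f := by
  have hkl2 : (k * l) % 2 = 1 := by omega
  have hklo : Odd k ∧ Odd l := Int.odd_mul.1 (Int.odd_iff.2 hkl2)
  have hβ : (2 * k + l * t) ^ 2 = t * (k ^ 2 * t' + 4 * k * l + l ^ 2 * t) := by
    linear_combination -k ^ 2 * htt
  have hnt : nm t = 4 := by
    rcases htw with rfl | rfl <;> rfl
  have hnv : nm (k ^ 2 * t' + 4 * k * l + l ^ 2 * t) = r ^ 2 := by
    have := congrArg nm hβ
    rw [nm_mul, hnt, pow_two, nm_mul, hnm] at this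
    linarith
  refine hasFourMul_of_sq_eq ht htt htw hklo.1 hklo.2 rfl (hu _ ?_ fun I hI hvI => ⟨?_, ?_⟩)
  · intro h
    rw [h] at hnv
    have : r ^ 2 = 0 := by rw [← hnv]; simp
    have : r = 0 := by simpa using this
    omega
  · refine hI.mem_of_pow_mem 2 ?_
    have := self_mul_star (k ^ 2 * t' + 4 * k * l + l ^ 2 * t)
    rw [hnv] at this
    push_cast at this
    rw [← this]
    exact I.mul_mem_right _ hvI
  · refine hI.mem_of_pow_mem 2 ?_
    rw [hβ]
    exact I.mul_mem_left _ hvI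

lemma hasFourMul_of_isPrime {p : Ideal QO} (hp : p.IsPrime) (hp0 : p ≠ ⊥) (hp2 : 2 ∉ p)
    (hpu : ∀ x : QO, x ≠ 0 → (∀ I : Ideal QO, I.IsPrime → x ∈ I → p ≤ I) → IsUnit (f x)) :
    HasFourMul f := by
  obtain ⟨r, hr, hrp⟩ := exists_prime_forall_intCast_mem hp hp0
  have hr2 : r ≠ 2 := by
    rintro rfl
    exact hp2 (by simpa using (hrp 2).2 dvd_rfl)
  have hrodd : r % 2 = 1 := Nat.odd_iff.1 (hr.odd_of_ne_two hr2)
  have hrP : Prime (r : ℤ) := Nat.prime_iff_prime_int.1 hr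
  have hrmem : ((r : ℤ) : QO) ∈ p := (hrp r).2 dvd_rfl
  have hr0 : ((r : ℤ) : QO) ≠ 0 := by exact_mod_cast hr.ne_zero
  by_cases hc : ∃ c : ℤ, w - c ∈ p
  · obtain ⟨c, hc⟩ := hc
    have hrc : (r : ℤ) ∣ c ^ 2 - c + 4 := by
      rw [← hrp]
      have : ((c ^ 2 - c + 4 : ℤ) : QO) = (w - c) * (1 - c - w) := by
        have hw : w * w = w - 4 := rfl
        push_cast
        linear_combination hw
      rw [this]
      exact p.mul_mem_right _ hc
    obtain ⟨x, y, hxy⟩ := exists_nm_eq (by exact_mod_cast hr.pos) hrc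
    obtain ⟨β, hβ⟩ : ∃ β : QO, β = x * (r : ℤ) + y * (w - c) := ⟨_, rfl⟩
    rw [← hβ] at hxy
    have hβp : β ∈ p := by
      rw [hβ]; exact add_mem (p.mul_mem_left _ hrmem) (p.mul_mem_left _ hc)
    have hβr : (r : ℤ) ∣ nm β := by
      rcases hxy with h | h <;> rw [h]
      exact dvd_mul_left _ _
    have hβr2 : ¬ (r : ℤ) ^ 2 ∣ nm β := by
      intro h
      have h1 : (r : ℤ) ^ 2 ∣ r * 2 := h.trans (by
        rcases hxy with h | h <;> rw [h]
        · exact dvd_mul_right _ _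
        · rw [mul_comm])
      rw [pow_two, mul_dvd_mul_iff_left hrP.ne_zero] at h1
      have := Int.le_of_dvd (by norm_num) h1
      have := hr.two_le
      omega
    have hle : ∀ I : Ideal QO, ((r : ℤ) : QO) ∈ I → β ∈ I → p ≤ I := by
      intro I hrI hβI
      obtain ⟨t, ht⟩ := exists_w_sub_intCast_mem (I := p ⊓ I) ⟨hrmem, hrI⟩ ⟨hβp, hβI⟩
        (isCoprime_im hrP hβr2 hβr)
      exact le_of_w_sub_mem (fun n => (hrp n).1) ht.1 hrI ht.2
    have hβ0 : β ≠ 0 := by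
      rintro rfl
      exact hβr2 (by simp)
    rcases hxy with hxy | hxy
    · have hu : IsUnit (f β) := by
        refine hpu β hβ0 fun I hI hβI => hle I ?_ hβI
        rw [← hxy, ← self_mul_star]
        exact I.mul_mem_right _ hβI
      refine hasFourMul_of_unit hu hr hr2 ?_ ?_ (Or.inl hxy)
      · rintro rfl; exact nm_ne_three _ hxy
      · rintro rfl; exact nm_ne_five _ hxy
    · have hn := hxy
      rw [nm_def] at hn
      have h1 : (β.re * (β.re + β.im)) % 2 = 0 := by
        have : β.re * (β.re + β.im) = β.re ^ 2 + β.re * β.im := by ring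
        omega
      rcases Int.even_mul.1 (Int.even_iff.2 h1) with h | h
      · obtain ⟨k, hk⟩ := h
        have hβk : β = 2 * k + β.im * w := by
          conv_lhs => rw [eq_add β, hk]
          push_cast; ring
        refine hasFourMul_of_nm_eq (t := w) (t' := w') (k := k) (l := β.im) (r := r) (by omega)
          (by rfl) (by rfl) (Or.inl rfl) ?_ (by rw [← hβk, hxy]) ?_
        · rw [hk] at hn; linarith
        · rw [← hβk]
          exact fun x hx h => hpu x hx fun I hI hxI => hle I (h I hI hxI).1 (h I hI hxI).2
      · obtain ⟨k, hk⟩ := h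
        have hβk : β = 2 * k + (-β.im : ℤ) * w' := by
          have e : β.re = 2 * k - β.im := by linarith
          have hw : w' = 1 - w := rfl
          conv_lhs => rw [eq_add β, e]
          rw [hw]
          push_cast; ring
        refine hasFourMul_of_nm_eq (t := w') (t' := w) (k := k) (l := -β.im) (r := r) (by omega)
          (by rfl) (by rfl) (Or.inr rfl) ?_ (by rw [← hβk, hxy]) ?_
        · have e : β.re = 2 * k - β.im := by linarith
          rw [e] at hn; linarith
        · rw [← hβk]
          exact fun x hx h => hpu x hx fun I hI hxI => hle I (h I hI hxI).1 (h I hI hxI).2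
  · push Not at hc
    have hu : IsUnit (f (r : ℤ)) := by
      refine hpu _ hr0 fun I hI hrI x hx => ?_
      have him : (r : ℤ) ∣ x.im := by
        by_contra h
        obtain ⟨t, ht⟩ := exists_w_sub_intCast_mem hrmem hx (hrP.coprime_iff_not_dvd.2 h)
        exact hc t ht
      have hxe := eq_add x
      have hre : (r : ℤ) ∣ x.re := by
        rw [← hrp]
        obtain ⟨y, hy⟩ := him
        have : (x.re : QO) = x - r * (y * w) := by
          rw [hy] at hxe; push_cast at hxe; linear_combination -hxe
        rw [this]
        exact sub_mem hx (p.mul_mem_right _ hrmem)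
      rw [hxe]
      exact add_mem (I.mem_of_dvd (intCast_dvd_intCast.2 hre) hrI)
        (I.mul_mem_right _ (I.mem_of_dvd (intCast_dvd_intCast.2 him) hrI))
    refine hasFourMul_of_unit hu hr hr2 ?_ ?_ (Or.inr rfl)
    · rintro rfl
      refine hc (-1) (hp.mem_of_pow_mem 2 ?_)
      have : (w - ((-1 : ℤ) : QO)) ^ 2 = ((3 : ℕ) : ℤ) * (w - 1) := by rfl
      rw [this]
      exact p.mul_mem_right _ hrmem
    · rintro rfl
      refine hc 3 (hp.mem_of_pow_mem 2 ?_)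
      have : (w - ((3 : ℤ) : QO)) ^ 2 = ((5 : ℕ) : ℤ) * (1 - w) := by rfl
      rw [this]
      exact p.mul_mem_right _ hrmem

end

end QO

section Characters

/-- A map on `2 × 2` matrices which is a homomorphism on `SL₂(ℤ/4)` and on `SL₂(ℤ/3)`. -/
def slChar {R : Type*} [CommRing R] (a b c d : R) : R :=
  (1 - c ^ 2) * (b * d + 3 * (c - 1) * d + c + 3) + c * (a + d - 3)

/-- `slChar` is a homomorphism on `SL₂(R)` with value `1` on the standard unipotent. -/
def IsSLChar (R : Type*) [CommRing R] : Prop :=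
  ∀ a b c d x : R, a * d - b * c = 1 →
    slChar a (a * x + b) c (c * x + d) = slChar a b c d + x ∧
    slChar (a + b * x) b (c + d * x) d = slChar a b c d - x

set_option maxRecDepth 100000 in
lemma isSLChar_four : IsSLChar (ZMod 4) := by
  unfold IsSLChar slChar; decide +kernel

set_option maxRecDepth 100000 in
lemma isSLChar_three : IsSLChar (ZMod 3) := by
  unfold IsSLChar slChar; decide +kernel

variable {A : Type*} [CommRing A]

lemma exists_addHom_of_isSLChar {R : Type*} [CommRing R] (hR : IsSLChar R) (χ : A →+* R)
    (h : elemSubgroup A = ⊤) : ∃ F : SL2ab A →+ R, ∀ a, F (elemHom A a) = χ a := by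
  obtain ⟨G, hG⟩ : ∃ G : Matrix.SpecialLinearGroup (Fin 2) A → R,
    ∀ g, G g = slChar (χ (g 0 0)) (χ (g 0 1)) (χ (g 1 0)) (χ (g 1 1)) := ⟨_, fun _ => rfl⟩
  have hdet : ∀ g : Matrix.SpecialLinearGroup (Fin 2) A,
      χ (g 0 0) * χ (g 1 1) - χ (g 0 1) * χ (g 1 0) = 1 := by
    intro g
    rw [← map_mul, ← map_mul, ← map_sub, sl_det, map_one]
  have h12 : ∀ g x, G (g * e12 x) = G g + χ x := by
    intro g x
    rw [hG, hG, ← (hR _ _ _ _ (χ x) (hdet g)).1]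
    simp [sl_mul]
  have h21 : ∀ g x, G (g * e21 x) = G g - χ x := by
    intro g x
    rw [hG, hG, ← (hR _ _ _ _ (χ x) (hdet g)).2]
    simp [sl_mul]
  have h1 : G 1 = 0 := by rw [hG]; simp [slChar]
  have hmul : ∀ g k, G (g * k) = G g + G k := by
    intro g k
    have hk : k ∈ elemSubgroup A := by rw [h]; trivial
    unfold elemSubgroup at hk
    induction hk using Subgroup.closure_induction generalizing g with
    | mem x hx =>
      have hx1 := h12 1
      have hx2 := h21 1
      rcases hx with ⟨x, rfl⟩ | ⟨x, rfl⟩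
      · have := hx1 x
        rw [one_mul, h1, zero_add] at this
        rw [h12, this]
      · have := hx2 x
        rw [one_mul, h1, zero_sub] at this
        rw [h21, this, sub_eq_add_neg]
    | one => simp [h1]
    | mul x y _ _ hx hy => rw [← mul_assoc, hy, hx, hy, add_assoc]
    | inv x _ hx =>
      have e1 := hx (g * x⁻¹)
      have e2 := hx x⁻¹
      rw [inv_mul_cancel, h1] at e2
      rw [inv_mul_cancel_right] at e1
      rw [e1, add_assoc, add_comm (G x), ← e2, add_zero]
  let H : Matrix.SpecialLinearGroup (Fin 2) A →* Multiplicative R :=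
    { toFun := fun g => Multiplicative.ofAdd (G g)
      map_one' := by rw [h1]; rfl
      map_mul' := fun g k => by rw [hmul]; rfl }
  refine ⟨MonoidHom.toAdditiveLeft (Abelianization.lift H), fun a => ?_⟩
  have : G (e12 a) = χ a := by
    have := h12 1 a
    rwa [one_mul, h1, zero_add] at this
  rw [elemHom_apply, ← this]
  rfl

lemma nonempty_addEquiv_of_family (h : elemSubgroup A = ⊤) {I J : Type*} {χ : I → A →+* ZMod 4}
    {ψ : J → A →+* ZMod 3}
    (hsurj : ∀ (x : I → ZMod 4) (y : J → ZMod 3), ∃ a, (∀ i, χ i a = x i) ∧ ∀ j, ψ j a = y j)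
    (hker : ∀ a, (∀ i, χ i a = 0) → (∀ j, ψ j a = 0) → a ∈ relKer A) :
    Nonempty (SL2ab A ≃+ (I → ZMod 4) × (J → ZMod 3)) := by
  choose F hF using fun i => exists_addHom_of_isSLChar isSLChar_four (χ i) h
  choose F' hF' using fun j => exists_addHom_of_isSLChar isSLChar_three (ψ j) h
  refine ⟨AddEquiv.ofBijective
    ((AddMonoidHom.pi F).prod (AddMonoidHom.pi F')) ⟨?_, ?_⟩⟩
  · rw [injective_iff_map_eq_zero]
    intro z hz
    obtain ⟨a, rfl⟩ := elemHom_surjective h z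
    rw [← mem_relKer]
    have h1 := congrArg Prod.fst hz
    have h2 := congrArg Prod.snd hz
    refine hker a (fun i => ?_) fun j => ?_
    · rw [← hF]; exact congrFun h1 i
    · rw [← hF']; exact congrFun h2 j
  · rintro ⟨x, y⟩
    obtain ⟨a, ha, ha'⟩ := hsurj x y
    refine ⟨elemHom A a, Prod.ext (funext fun i => ?_) (funext fun j => ?_)⟩
    · exact (hF i a).trans (ha i)
    · exact (hF' j a).trans (ha' j)

end Characters

namespace QO

/-- Some ideal in `S` contains `r` and `ω - t`. -/
abbrev HasPrimeOver (S : Set (Ideal QO)) (r : ℕ) (t : ℤ) : Prop :=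
  ∃ I ∈ S, (r : QO) ∈ I ∧ w - t ∈ I

/-- The homomorphism sending `ω` to `t`. -/
def evalHom {R : Type*} [CommRing R] (t : R) (ht : t ^ 2 - t + 4 = 0) : QO →+* R where
  toFun x := x.re + x.im * t
  map_zero' := by simp
  map_one' := by simp
  map_add' x y := by simp; ring
  map_mul' x y := by
    simp
    linear_combination (-(x.im * y.im : R)) * ht

lemma evalHom_apply {R : Type*} [CommRing R] (t : R) (ht : t ^ 2 - t + 4 = 0) (x : QO) :
    evalHom t ht x = x.re + x.im * t := rfl

section

variable {A : Type*} [CommRing A] {f : QO →+* A} {P : QO} {S : Set (Ideal QO)}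

lemma IsSLocalization.exists_ringHom (hf : IsSLocalization f P) {R : Type*} [CommRing R]
    (g : QO →+* R) (hg : IsUnit (g P)) : ∃ χ : A →+* R, ∀ x, χ (f x) = g x := by
  let _ := f.toAlgebra
  have : IsLocalization.Away P A := by
    refine IsLocalization.Away.mk P hf.isUnit (fun a => ?_) fun a b h => ⟨0, ?_⟩
    · obtain ⟨k, x, hx⟩ := hf.exists_mul_eq a
      exact ⟨k, x, by rw [mul_comm]; exact hx⟩
    · rw [hf.inj h]
  exact ⟨IsLocalization.Away.lift P hg, fun x => IsLocalization.Away.lift_eq P hg x⟩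

lemma IsSLocalization.exists_character (hf : IsSLocalization f P)
    (hP : ∀ J : Ideal QO, J.IsPrime → P ∈ J → J ∈ S) {r e : ℕ} (hr : r.Prime) (he : e ≠ 0) {t : ℤ}
    (ht : ((r ^ e : ℕ) : ℤ) ∣ t ^ 2 - t + 4) (h : ¬ HasPrimeOver S r t) :
    ∃ χ : A →+* ZMod (r ^ e), ∀ x, χ (f x) = x.re + x.im * t := by
  have : Fact r.Prime := ⟨hr⟩
  have ht' : ((t : ℤ) : ZMod (r ^ e)) ^ 2 - t + 4 = 0 := by
    have := (ZMod.intCast_zmod_eq_zero_iff_dvd _ _).2 ht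
    exact_mod_cast this
  have htr : ((t : ℤ) : ZMod r) ^ 2 - t + 4 = 0 := by
    have : (r : ℤ) ∣ t ^ 2 - t + 4 := by
      refine dvd_trans ?_ ht
      exact_mod_cast dvd_pow_self r he
    have := (ZMod.intCast_zmod_eq_zero_iff_dvd _ _).2 this
    exact_mod_cast this
  refine hf.exists_ringHom (evalHom _ ht') ?_
  by_contra hu
  refine h ⟨RingHom.ker (evalHom _ htr), hP _ (RingHom.ker_isPrime _) ?_, ?_, ?_⟩
  · rw [RingHom.mem_ker, evalHom_apply]
    rw [evalHom_apply] at hu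
    have h1 : ¬ IsCoprime (P.re + P.im * t) ((r ^ e : ℕ) : ℤ) := by
      intro h
      apply hu
      have := (ZMod.coe_int_isUnit_iff_isCoprime (P.re + P.im * t) (r ^ e)).2 h.symm
      exact_mod_cast this
    push_cast at h1
    rw [IsCoprime.pow_right_iff (Nat.pos_of_ne_zero he), isCoprime_comm,
      (Nat.prime_iff_prime_int.1 hr).coprime_iff_not_dvd, not_not] at h1
    have := (ZMod.intCast_zmod_eq_zero_iff_dvd _ _).2 h1
    exact_mod_cast this
  · rw [RingHom.mem_ker, map_natCast, ZMod.natCast_self]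
  · rw [RingHom.mem_ker, evalHom_apply]
    simp

lemma le_of_mem_of_mem {I J : Ideal QO} (hI : I.IsPrime) (hI0 : I ≠ ⊥) {r : ℕ} (hr : r.Prime)
    {t : ℤ} (hrI : (r : QO) ∈ I) (htI : w - t ∈ I) (hrJ : (r : QO) ∈ J) (htJ : w - t ∈ J) :
    I ≤ J := by
  obtain ⟨r', hr', h⟩ := exists_prime_forall_intCast_mem hI hI0
  have : r' = r := by
    have := (h r).1 (by exact_mod_cast hrI)
    exact (Nat.prime_dvd_prime_iff_eq hr' hr).1 (by exact_mod_cast this)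
  subst this
  exact le_of_w_sub_mem (fun n => (h n).1) htI (by exact_mod_cast hrJ) htJ

end

/-- `S` is a nonempty set of nonzero primes, consisting of the prime divisors of `P`, all of which
become invertible under `f`. -/
structure IsPrimeSupport {A : Type*} [CommRing A] (f : QO →+* A) (P : QO) (S : Set (Ideal QO)) :
    Prop where
  nonempty : S.Nonempty
  isPrime : ∀ I ∈ S, I.IsPrime
  ne_bot : ∀ I ∈ S, I ≠ ⊥
  mem_of_mem : ∀ J : Ideal QO, J.IsPrime → P ∈ J → J ∈ S
  isUnit : ∀ x : QO, x ≠ 0 → (∀ J : Ideal QO, J.IsPrime → x ∈ J → ∃ I ∈ S, I ≤ J) → IsUnit (f x)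

section

variable {A : Type*} [CommRing A] {f : QO →+* A} {P : QO} {S : Set (Ideal QO)}

lemma IsPrimeSupport.isUnit_of_mem (hS : IsPrimeSupport f P S) {r : ℕ} (hr : r.Prime) {t : ℤ}
    (h : HasPrimeOver S r t) {x : QO} (hx : x ≠ 0)
    (hxJ : ∀ J : Ideal QO, J.IsPrime → x ∈ J → (r : QO) ∈ J ∧ w - t ∈ J) : IsUnit (f x) := by
  obtain ⟨I, hI, h1, h2⟩ := h
  refine hS.isUnit x hx fun J hJ hxm => ⟨I, hI, ?_⟩
  exact le_of_mem_of_mem (hS.isPrime I hI) (hS.ne_bot I hI) hr h1 h2 (hxJ J hJ hxm).1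
    (hxJ J hJ hxm).2

lemma two_mem_of_four_mem {J : Ideal QO} (hJ : J.IsPrime) (h : 4 ∈ J) : 2 ∈ J := by
  refine hJ.mem_of_pow_mem 2 ?_
  have : (2 : QO) ^ 2 = 4 := rfl
  rwa [this]

lemma IsPrimeSupport.isUnit_w (hS : IsPrimeSupport f P S)
    (h : HasPrimeOver S 2 0) : IsUnit (f w) := by
  refine hS.isUnit_of_mem Nat.prime_two h (fun h => ?_) fun J hJ hw => ⟨?_, by simpa using hw⟩
  · simpa using congrArg QuadraticAlgebra.im h
  · refine two_mem_of_four_mem hJ ?_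
    have : (4 : QO) = w * (1 - w) := rfl
    rw [this]
    exact J.mul_mem_right _ hw

lemma IsPrimeSupport.isUnit_w_sub_one (hS : IsPrimeSupport f P S)
    (h : HasPrimeOver S 2 1) : IsUnit (f (w - 1)) := by
  refine hS.isUnit_of_mem Nat.prime_two h (fun h => ?_) fun J hJ hw => ⟨?_, by simpa using hw⟩
  · simpa using congrArg QuadraticAlgebra.im h
  · refine two_mem_of_four_mem hJ ?_
    have : (4 : QO) = (w - 1) * (-w) := rfl
    rw [this]
    exact J.mul_mem_right _ hw

lemma IsPrimeSupport.isUnit_three (hS : IsPrimeSupport f P S)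
    (h : HasPrimeOver S 3 (-1)) : IsUnit (f 3) := by
  refine hS.isUnit_of_mem Nat.prime_three h (fun h => ?_) fun J hJ hw => ⟨hw, ?_⟩
  · simpa using congrArg QuadraticAlgebra.re h
  · refine hJ.mem_of_pow_mem 2 ?_
    have : (w - ((-1 : ℤ) : QO)) ^ 2 = 3 * (w - 1) := rfl
    rw [this]
    exact J.mul_mem_right _ hw

lemma IsPrimeSupport.hasFourMul (hS : IsPrimeSupport f P S)
    (h0 : ¬ HasPrimeOver S 2 0)
    (h1 : ¬ HasPrimeOver S 2 1) : HasFourMul f := by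
  obtain ⟨p, hp⟩ := hS.nonempty
  refine hasFourMul_of_isPrime (hS.isPrime p hp) (hS.ne_bot p hp) (fun h2 => ?_)
    fun x hx hxJ => hS.isUnit x hx fun J hJ hm => ⟨p, hp, hxJ J hJ hm⟩
  have h4 : w * (w - 1) ∈ p := by
    have : w * (w - 1) = 2 * (-2) := rfl
    rw [this]
    exact p.mul_mem_right _ h2
  rcases (hS.isPrime p hp).mem_or_mem h4 with h | h
  · exact h0 ⟨p, hp, h2, by simpa using h⟩
  · exact h1 ⟨p, hp, h2, by simpa using h⟩

lemma IsPrimeSupport.isUnit_or_isCoprime (hS : IsPrimeSupport f P S) :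
    IsUnit (f w') ∨ IsCoprime P w' := by
  by_cases h : IsCoprime P w'
  · exact Or.inr h
  left
  rw [← Ideal.isCoprime_span_singleton_iff, Ideal.isCoprime_iff_sup_eq] at h
  obtain ⟨J, hJ, hle⟩ := Ideal.exists_le_maximal _ h
  rw [sup_le_iff, Ideal.span_singleton_le_iff_mem, Ideal.span_singleton_le_iff_mem] at hle
  have hw : w' = -(w - 1) := rfl
  rw [hw, neg_mem_iff] at hle
  have h4 : (4 : QO) ∈ J := by
    have : (4 : QO) = (w - 1) * (-w) := rfl
    rw [this]
    exact J.mul_mem_right _ hle.2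
  rw [hw, map_neg]
  exact (hS.isUnit_w_sub_one ⟨J, hS.mem_of_mem J hJ.isPrime hle.1,
    two_mem_of_four_mem hJ.isPrime h4, by simpa using hle.2⟩).neg

lemma IsPrimeSupport.mem_relKer (hS : IsPrimeSupport f P S) (hf : IsSLocalization f P) {x : QO}
    (h0 : HasPrimeOver S 2 0 ∨ 4 ∣ x.re)
    (h1 : HasPrimeOver S 2 1 ∨ 4 ∣ x.re + x.im)
    (h3 : HasPrimeOver S 3 (-1) ∨ 3 ∣ x.re - x.im) :
    f x ∈ relKer A := by
  have hx : f x = x.re + x.im * f w := by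
    conv_lhs => rw [eq_add x]
    simp
  have h12 : (12 : A) ∈ relKer A := twelve_mem_relKer
  have hw2 : f w * f w = f w - 4 := by
    rw [← map_mul, show w * w = w - 4 from rfl, map_sub, map_ofNat]
  have a0 : HasPrimeOver S 2 0 → f w - 5 ∈ relKer A := by
    intro h
    have := sq_sub_one_mul_mem (hS.isUnit_w h) 1
    convert this using 1
    linear_combination -hw2
  have a1 : HasPrimeOver S 2 1 → f w + 4 ∈ relKer A := by
    intro h
    have := neg_mem (sq_sub_one_mul_mem (hS.isUnit_w_sub_one h) 1)
    convert this using 1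
    rw [map_sub, map_one]
    linear_combination hw2
  have a3 : HasPrimeOver S 3 (-1) → (8 : A) ∈ relKer A := by
    intro h
    have h3 := hS.isUnit_three h
    rw [map_ofNat] at h3
    have := sq_sub_one_mul_mem h3 1
    convert this using 1
    norm_num
  have int : ∀ n : ℤ, ∀ m : ℕ, (m : A) ∈ relKer A → (m : ℤ) ∣ n → (n : A) ∈ relKer A := by
    rintro _ m hm ⟨k, rfl⟩
    have := zsmul_mem hm k
    rw [zsmul_eq_mul] at this
    convert this using 1
    push_cast; ring
  have four : ∀ n : ℤ, 4 ∣ n → (HasPrimeOver S 3 (-1) ∨ 3 ∣ n) →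
      (n : A) ∈ relKer A := by
    intro n hn h
    rcases h with h | h
    · refine int n 4 ?_ (by exact_mod_cast hn)
      have := sub_mem h12 (a3 h)
      convert this using 1
      norm_num
    · exact int n 12 (by exact_mod_cast h12) (by omega)
  by_cases u0 : HasPrimeOver S 2 0
  · have e : f x = ((x.re + 5 * x.im : ℤ) : A) + x.im • (f w - 5) := by
      rw [hx, zsmul_eq_mul]; push_cast; ring
    rw [e]
    refine add_mem ?_ (zsmul_mem (a0 u0) _)
    by_cases u1 : HasPrimeOver S 2 1
    · have h9 : (9 : A) ∈ relKer A := by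
        have := sub_mem (a1 u1) (a0 u0)
        convert this using 1
        ring
      rcases h3 with h | h
      · refine int _ 1 ?_ (one_dvd _)
        have := sub_mem h9 (a3 h)
        convert this using 1
        norm_num
      · refine int _ 3 ?_ (by push_cast; omega)
        have := sub_mem h12 h9
        convert this using 1
        norm_num
    · rcases h1 with h | h1
      · exact absurd h u1
      · exact four _ (by omega) (h3.imp_right (by omega))
  · replace h0 := h0.resolve_left u0
    by_cases u1 : HasPrimeOver S 2 1
    · have e : f x = ((x.re - 4 * x.im : ℤ) : A) + x.im • (f w + 4) := by
        rw [hx, zsmul_eq_mul]; push_cast; ring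
      rw [e]
      exact add_mem (four _ (by omega) (h3.imp_right (by omega))) (zsmul_mem (a1 u1) _)
    · replace h1 := h1.resolve_left u1
      obtain ⟨y, hy⟩ : ∃ y, x.im = 4 * y := ⟨x.im / 4, by omega⟩
      have e : f x = ((x.re - 4 * y : ℤ) : A) + y • (4 * (f w + 1)) := by
        rw [hx, zsmul_eq_mul, hy]; push_cast; ring
      rw [e]
      exact add_mem (four _ (by omega) (h3.imp_right (by omega)))
        (zsmul_mem (hf.four_mul_mem (hS.hasFourMul u0 u1)) _)

end


variable {A : Type*} [CommRing A] {f : QO →+* A} {P : QO} {S : Set (Ideal QO)}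

lemma IsPrimeSupport.nonempty_addEquiv (hS : IsPrimeSupport f P S) (hf : IsSLocalization f P) :
    Nonempty (SL2ab A ≃+ ({i : Fin 2 // ¬ HasPrimeOver S 2 (i : ℕ)} → ZMod 4) ×
      ({_j : Unit // ¬ HasPrimeOver S 3 (-1)} → ZMod 3)) := by
  have hχ : ∀ i : {i : Fin 2 // ¬ HasPrimeOver S 2 (i : ℕ)},
      ∃ χ : A →+* ZMod 4, ∀ x, χ (f x) = x.re + x.im * ((i : Fin 2) : ℕ) := by
    rintro ⟨i, hi⟩
    have := hf.exists_character hS.mem_of_mem Nat.prime_two two_ne_zero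
      (t := ((i : ℕ) : ℤ)) (by fin_cases i <;> norm_num) hi
    obtain ⟨χ, hχ⟩ := this
    exact ⟨χ, fun x => by rw [hχ x]; push_cast; rfl⟩
  have hψ : ∀ _ : {_j : Unit // ¬ HasPrimeOver S 3 (-1)},
      ∃ ψ : A →+* ZMod 3, ∀ x, ψ (f x) = x.re - x.im := by
    rintro ⟨-, h⟩
    obtain ⟨ψ, hψ⟩ := hf.exists_character hS.mem_of_mem Nat.prime_three one_ne_zero
      (t := -1) (by norm_num) h
    refine ⟨ψ, fun x => (hψ x).trans ?_⟩
    push_cast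
    rw [mul_neg_one, ← sub_eq_add_neg]
  choose χ hχ using hχ
  choose ψ hψ using hψ
  have hχ0 : ∀ i a, χ i (12 * a) = 0 := by
    intro i a
    rw [map_mul, map_ofNat, show (12 : ZMod 4) = 0 from rfl, zero_mul]
  have hψ0 : ∀ j a, ψ j (12 * a) = 0 := by
    intro j a
    rw [map_mul, map_ofNat, show (12 : ZMod 3) = 0 from rfl, zero_mul]
  refine nonempty_addEquiv_of_family (elemSubgroup_eq_top hf hS.isUnit_or_isCoprime)
    (χ := χ) (ψ := ψ) (fun x y => ?_) fun a ha ha' => ?_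
  · classical
    obtain ⟨X, hX⟩ : ∃ X : Fin 2 → ℤ, ∀ i, (X i.1 : ZMod 4) = x i := by
      choose g hg using ZMod.intCast_surjective (n := 4)
      exact ⟨fun i => if h : ¬ HasPrimeOver S 2 (i : ℕ) then g (x ⟨i, h⟩) else 0,
        fun i => by simp only [dif_pos i.2, hg]⟩
    obtain ⟨Y, hY⟩ : ∃ Y : ℤ, ∀ j, (Y : ZMod 3) = y j := by
      by_cases h : ¬ HasPrimeOver S 3 (-1)
      · obtain ⟨Y, hY⟩ := ZMod.intCast_surjective (y ⟨(), h⟩)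
        exact ⟨Y, fun j => hY⟩
      · exact ⟨0, fun j => absurd j.2 h⟩
    refine ⟨f ⟨9 * X 0 + 4 * Y, 9 * (X 1 - X 0)⟩, fun i => ?_, fun j => ?_⟩
    · rw [hχ, ← hX]
      push_cast
      rw [show (9 : ZMod 4) = 1 from rfl, show (4 : ZMod 4) = 0 from rfl]
      obtain ⟨i, hi⟩ := i
      fin_cases i <;> simp
    · rw [hψ, ← hY]
      push_cast
      rw [show (9 : ZMod 3) = 0 from rfl, show (4 : ZMod 3) = 1 from rfl]
      ring
  · obtain ⟨n, hn, -, hnN⟩ := hf.exists_int_mul_mem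
    obtain ⟨x, b, rfl⟩ := hf.exists_eq_add_mul (n := 12 * n) (by omega) a
    have e : ((12 * n : ℤ) : A) * b = 12 * (n * b) := by push_cast; ring
    have e' : ((12 * n : ℤ) : A) * b = n * (12 * b) := by push_cast; ring
    simp only [e, map_add, hχ0, hψ0, add_zero, hχ, hψ] at ha ha'
    rw [e']
    refine add_mem (hS.mem_relKer hf ?_ ?_ ?_) (hnN _)
    · refine or_iff_not_imp_left.2 fun h => ?_
      have := ha ⟨0, h⟩
      refine (ZMod.intCast_zmod_eq_zero_iff_dvd _ 4).1 ?_
      simpa using this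
    · refine or_iff_not_imp_left.2 fun h => ?_
      have := ha ⟨1, h⟩
      refine (ZMod.intCast_zmod_eq_zero_iff_dvd _ 4).1 ?_
      simpa using this
    · refine or_iff_not_imp_left.2 fun h => ?_
      have := ha' ⟨(), h⟩
      refine (ZMod.intCast_zmod_eq_zero_iff_dvd _ 3).1 ?_
      simpa using this

end QO

section SIntegers

variable {R : Type*} [CommRing R] [IsDedekindDomain R]

lemma IsDedekindDomain.exists_span_eq_pow [Finite (ClassGroup R)] {I : Ideal R} (hI : I ≠ ⊥) :
    ∃ π : R, Ideal.span {π} = I ^ Nat.card (ClassGroup R) := by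
  have h0 : I ∈ nonZeroDivisors (Ideal R) := mem_nonZeroDivisors_of_ne_zero hI
  have h1 : (I ^ Nat.card (ClassGroup R)).IsPrincipal := by
    rw [← ClassGroup.mk0_eq_one_iff (pow_mem h0 _), ← SubmonoidClass.mk_pow _ h0, map_pow,
      pow_card_eq_one']
  obtain ⟨π, hπ⟩ := h1
  exact ⟨π, hπ.symm⟩

lemma IsDedekindDomain.HeightOneSpectrum.eq_of_asIdeal_le {u v : HeightOneSpectrum R}
    (h : u.asIdeal ≤ v.asIdeal) : u = v :=
  HeightOneSpectrum.ext (u.isMaximal.eq_of_le v.isPrime.ne_top h)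

lemma IsDedekindDomain.exists_mem_iff_mem_finset [Finite (ClassGroup R)]
    (S : Finset (HeightOneSpectrum R)) :
    ∃ P : R, P ≠ 0 ∧ ∀ v : HeightOneSpectrum R, P ∈ v.asIdeal ↔ v ∈ S := by
  have hI : ∏ v ∈ S, v.asIdeal ≠ ⊥ := Finset.prod_ne_zero_iff.2 fun v _ => v.ne_bot
  obtain ⟨P, hP⟩ := IsDedekindDomain.exists_span_eq_pow hI
  refine ⟨P, ?_, fun v => ?_⟩
  · rintro rfl
    rw [Ideal.span_singleton_eq_bot.2 rfl] at hP
    exact pow_ne_zero _ hI hP.symm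
  · have hv := v.isPrime
    rw [← Ideal.span_singleton_le_iff_mem, hP, Ideal.IsPrime.pow_le_iff Nat.card_pos.ne',
      Ideal.IsPrime.prod_le hv]
    constructor
    · rintro ⟨u, hu, huv⟩
      rwa [← HeightOneSpectrum.eq_of_asIdeal_le huv]
    · exact fun h => ⟨v, h, le_rfl⟩

lemma IsDedekindDomain.exists_pow_eq_mul_of_finset [Finite (ClassGroup R)]
    (S T : Finset (HeightOneSpectrum R)) (hT : T ⊆ S) (d : R) (hd : d ≠ 0) :
    ∃ (h : ℕ) (δ g : R), δ ≠ 0 ∧ (∀ v : HeightOneSpectrum R, δ ∈ v.asIdeal → v ∈ S) ∧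
      d ^ (h + 1) = δ * g ∧ ∀ v ∈ T, g ∉ v.asIdeal := by
  classical
  induction T using Finset.induction_on with
  | empty => exact ⟨0, 1, d, one_ne_zero,
      fun v hv => (v.isPrime.ne_top ((Ideal.eq_top_iff_one _).2 hv)).elim, by simp, by simp⟩
  | insert u T _ ih =>
    obtain ⟨h, δ, g, hδ, hδS, hdg, hgT⟩ := ih fun v hv => hT (Finset.mem_insert_of_mem hv)
    have hg : g ≠ 0 := by
      rintro rfl
      exact pow_ne_zero _ hd (hdg.trans (mul_zero _))
    have hfin : FiniteMultiplicity u.asIdeal (Ideal.span {g}) :=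
      FiniteMultiplicity.of_prime_left u.prime (by simpa using hg)
    obtain ⟨J, hJ, huJ⟩ := hfin.exists_eq_pow_mul_and_not_dvd
    generalize multiplicity u.asIdeal (Ideal.span {g}) = k at hJ
    set c := Nat.card (ClassGroup R) with hc
    have hc0 : c ≠ 0 := Nat.card_pos.ne'
    obtain ⟨π, hπ⟩ := IsDedekindDomain.exists_span_eq_pow u.ne_bot
    rw [← hc] at hπ
    have hgc : Ideal.span {g ^ c} = Ideal.span {π ^ k} * J ^ c := by
      rw [← Ideal.span_singleton_pow, hJ, ← Ideal.span_singleton_pow, hπ, mul_pow, ← pow_mul,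
        ← pow_mul, mul_comm k]
    obtain ⟨g', hg'⟩ : π ^ k ∣ g ^ c := by
      rw [← Ideal.span_singleton_le_span_singleton, hgc]
      exact Ideal.mul_le_left
    have hπ0 : π ^ k ≠ 0 := by
      rintro h0
      exact pow_ne_zero c hg (by rw [hg', h0, zero_mul])
    have hJ' : Ideal.span {g'} = J ^ c := by
      have h0 : Ideal.span {π ^ k} ≠ 0 := by simpa using hπ0
      apply mul_left_cancel₀ h0
      rw [← hgc, hg', Ideal.span_singleton_mul_span_singleton]
    refine ⟨h * c + (c - 1), δ ^ c * π ^ k, g', mul_ne_zero (pow_ne_zero _ hδ) hπ0,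
      fun v hv => ?_, ?_, fun v hv hgv => ?_⟩
    · rcases v.isPrime.mem_or_mem hv with hv | hv
      · exact hδS v (v.isPrime.mem_of_pow_mem _ hv)
      · have h1 := v.isPrime.mem_of_pow_mem _ hv
        rw [← Ideal.span_singleton_le_iff_mem, hπ] at h1
        have := v.isPrime
        rw [← HeightOneSpectrum.eq_of_asIdeal_le ((Ideal.IsPrime.pow_le_iff hc0).1 h1)]
        exact hT (Finset.mem_insert_self _ _)
    · have : h * c + (c - 1) + 1 = (h + 1) * c := by
        rw [add_assoc, Nat.sub_add_cancel (Nat.pos_of_ne_zero hc0)]; ring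
      rw [this, pow_mul, hdg, mul_pow, hg', mul_assoc]
    · rcases Finset.mem_insert.1 hv with rfl | hv
      · have := v.isPrime
        rw [← Ideal.span_singleton_le_iff_mem, hJ', Ideal.IsPrime.pow_le_iff hc0] at hgv
        exact huJ (Ideal.dvd_iff_le.2 hgv)
      · refine hgT v hv (v.isPrime.mem_of_pow_mem c ?_)
        rw [hg']
        exact v.asIdeal.mul_mem_left _ hgv

variable {K : Type*} [Field K] [Algebra R K] [IsFractionRing R K]

lemma Set.isUnit_algebraMap_integer {S : Set (HeightOneSpectrum R)} {x : R} (hx : x ≠ 0)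
    (h : ∀ v : HeightOneSpectrum R, x ∈ v.asIdeal → v ∈ S) :
    IsUnit (algebraMap R (S.integer K) x) := by
  have hx' : algebraMap R K x ≠ 0 := by simpa using hx
  have hy : (algebraMap R K x)⁻¹ ∈ S.integer K := by
    intro v hv
    rw [map_inv₀, v.valuation_eq_one_iff_notMem.2 (mt (h v) hv), inv_one]
  refine IsUnit.of_mul_eq_one ⟨_, hy⟩ (Subtype.ext ?_)
  exact mul_inv_cancel₀ hx'

lemma Finset.exists_pow_mul_eq_algebraMap {S : Finset (HeightOneSpectrum R)} {P : R}
    (hP : ∀ v ∈ S, P ∈ v.asIdeal) (a : (S : Set (HeightOneSpectrum R)).integer K) :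
    ∃ (k : ℕ) (x : R), algebraMap R ((S : Set (HeightOneSpectrum R)).integer K) P ^ k * a =
      algebraMap R _ x := by
  have h1 : ∀ v ∈ S, ∃ k : ℕ, ∀ n ≥ k, v.valuation K (algebraMap R K P ^ n * a) ≤ 1 := by
    intro v hv
    have hP1 := (v.valuation_lt_one_iff_mem (K := K) P).2 (hP v hv)
    rcases eq_or_ne (v.valuation K (a : K)) 0 with h0 | h0
    · exact ⟨0, fun n _ => by rw [map_mul, h0, mul_zero]; exact zero_le_one⟩
    · obtain ⟨k, hk⟩ := exists_pow_lt₀ hP1 (Units.mk0 _ (inv_ne_zero h0))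
      refine ⟨k, fun n hn => ?_⟩
      rw [map_mul, map_pow]
      have h2 := (pow_le_pow_right_of_le_one' hP1.le hn).trans hk.le
      rw [Units.val_mk0] at h2
      exact (mul_le_mul_left h2 _).trans (inv_mul_cancel₀ h0).le
  choose! k hk using h1
  have h2 : ∀ v : HeightOneSpectrum R,
      v.valuation K (algebraMap R K P ^ (S.sup k) * a) ≤ 1 := by
    intro v
    by_cases hv : v ∈ S
    · exact hk v hv _ (Finset.le_sup hv)
    · rw [map_mul, map_pow]
      exact mul_le_one' (pow_le_one' (v.valuation_le_one P) _) (a.2 v hv)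
  obtain ⟨x, hx⟩ := HeightOneSpectrum.mem_integers_of_valuation_le_one K _ h2
  exact ⟨S.sup k, x, Subtype.ext hx.symm⟩

end SIntegers

section RingOfIntegers

lemma Rat.exists_intCast_eq_of_mul_sq {n : ℕ} (hn : Squarefree n) {m : ℚ} {k : ℤ}
    (h : n * m ^ 2 = k) : ∃ z : ℤ, m = z := by
  have hd : (m.den : ℤ) ^ 2 ∣ n := by
    have h1 : (n : ℤ) * m.num ^ 2 = k * (m.den : ℤ) ^ 2 := by
      have h2 : (m.den : ℚ) ≠ 0 := by exact_mod_cast m.den_ne_zero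
      have h3 : (n : ℚ) * m.num ^ 2 = k * (m.den : ℚ) ^ 2 := by
        rw [← h, mul_assoc, ← mul_pow, Rat.mul_den_eq_num]
      exact_mod_cast h3
    have hc : IsCoprime ((m.den : ℤ) ^ 2) (m.num ^ 2) :=
      (Int.isCoprime_iff_gcd_eq_one.2 (by
        rw [Int.gcd_comm]; exact m.reduced)).pow
    exact hc.dvd_of_dvd_mul_right ⟨k, by rw [h1, mul_comm]⟩
  have h1 : m.den * m.den ∣ n := by rw [← sq]; exact_mod_cast hd
  have h2 := Nat.isUnit_iff.1 (hn _ h1)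
  exact ⟨m.num, by conv_lhs => rw [← Rat.num_div_den m, h2, Nat.cast_one, div_one]⟩

/-- An element of `ℚ(ω)` with integral trace and norm lies in `ℤ[ω]`. -/
lemma QO.exists_int_of_isIntegral {x : QuadraticAlgebra ℚ (-4) 1} (hx : IsIntegral ℤ x) :
    ∃ a b : ℤ, x.re = a ∧ x.im = b := by
  have hx' : IsIntegral ℤ (star x) :=
    hx.map (starRingEnd (QuadraticAlgebra ℚ (-4) 1)).toIntAlgHom
  have key : ∀ r : ℚ, IsIntegral ℤ (algebraMap ℚ (QuadraticAlgebra ℚ (-4) 1) r) →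
      ∃ z : ℤ, (z : ℚ) = r := fun r hr =>
    IsIntegrallyClosed.isIntegral_iff.1 ((isIntegral_algHom_iff
      (algebraMap ℚ (QuadraticAlgebra ℚ (-4) 1)).toIntAlgHom
      QuadraticAlgebra.algebraMap_injective).1 hr)
  obtain ⟨T, hT⟩ := key (2 * x.re + x.im) (by
    convert hx.add hx' using 1
    ext <;> simp
    ring)
  obtain ⟨N, hN⟩ := key (x.re * x.re + x.re * x.im + 4 * (x.im * x.im)) (by
    convert hx.mul hx' using 1
    ext <;> simp <;> ring)
  obtain ⟨m, hm⟩ := Rat.exists_intCast_eq_of_mul_sq (n := 15) (k := 4 * N - T ^ 2)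
    (by decide +kernel) (m := x.im) (by push_cast; rw [hN, hT]; ring)
  have h4 : 4 * N = T ^ 2 + 15 * m ^ 2 := by
    have : (4 : ℚ) * N = T ^ 2 + 15 * m ^ 2 := by rw [hN, hT, ← hm]; ring
    exact_mod_cast this
  have h2 : (2 : ℤ) ∣ T - m := by
    have : (2 : ℤ) ∣ (T - m) ^ 2 := ⟨2 * N - 7 * m ^ 2 - T * m, by linear_combination -h4⟩
    exact Int.prime_two.dvd_of_dvd_pow this
  obtain ⟨a, ha⟩ := h2
  refine ⟨a, m, ?_, hm⟩
  have : (T : ℚ) - m = 2 * a := by exact_mod_cast ha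
  rw [hT, ← hm] at this
  linarith

variable {K : Type*} [Field K] [NumberField K]

lemma Rat.sq_ne_neg_fifteen (r : ℚ) : r ^ 2 ≠ -15 := by
  nlinarith [sq_nonneg r]

theorem QO.nonempty_ringEquiv (hdeg : Module.finrank ℚ K = 2) {α : K} (hα : α ^ 2 = -15) :
    Nonempty (QO ≃+* 𝓞 K) := by
  set t : K := (1 + α) / 2 with ht
  have ht2 : t ^ 2 - t + 4 = 0 := by rw [ht]; linear_combination hα / 4
  let φ : QuadraticAlgebra ℚ (-4) 1 →ₐ[ℚ] K :=
    QuadraticAlgebra.lift ⟨t, by 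
      rw [Algebra.smul_def, Algebra.smul_def]
      simp only [map_neg, map_ofNat, map_one]
      linear_combination ht2⟩
  have hφ : ∀ x, φ x = x.re + x.im * t := fun x => by
    simp [φ, QuadraticAlgebra.lift, Algebra.smul_def]
  have hinj : Function.Injective φ := by
    rw [injective_iff_map_eq_zero]
    intro x hx
    rw [hφ] at hx
    have him : x.im = 0 := by
      by_contra h0
      apply Rat.sq_ne_neg_fifteen (-(2 * x.re + x.im) / x.im)
      have h0' : (x.im : K) ≠ 0 := by exact_mod_cast h0
      have : ((-(2 * x.re + x.im) / x.im : ℚ) : K) = α := by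
        push_cast
        rw [div_eq_iff h0']
        rw [ht] at hx
        linear_combination -2 * hx
      apply (Rat.cast_injective (α := K))
      push_cast [← hα]
      rw [← this]
      push_cast
      rfl
    rw [him] at hx
    refine QuadraticAlgebra.ext ?_ him
    simpa using hx
  have hsurj : Function.Surjective φ := by
    refine (LinearMap.injective_iff_surjective_of_finrank_eq_finrank (f := φ.toLinearMap) ?_).1 hinj
    rw [hdeg, QuadraticAlgebra.finrank_eq_two]
  have hti : IsIntegral ℤ t := by
    refine ⟨Polynomial.X ^ 2 - Polynomial.X + Polynomial.C 4, ?_, ?_⟩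
    · monicity!
    · simpa using ht2
  obtain ⟨τ, hτt⟩ : ∃ τ : 𝓞 K, (τ : K) = t := ⟨⟨t, hti⟩, rfl⟩
  have hτ : τ ^ 2 - τ + 4 = 0 := RingOfIntegers.ext (by
    simp only [map_add, map_sub, map_pow, map_ofNat, map_zero, hτt, ht2])
  refine ⟨RingEquiv.ofBijective (QO.evalHom τ hτ) ⟨?_, fun y => ?_⟩⟩
  · rw [injective_iff_map_eq_zero]
    intro x hx
    have h1 : φ ⟨x.re, x.im⟩ = 0 := by
      rw [hφ]
      have := congrArg (algebraMap (𝓞 K) K) hx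
      simpa only [QO.evalHom_apply, map_add, map_mul, map_intCast, map_zero, hτt,
        Rat.cast_intCast] using this
    have h2 := (map_eq_zero_iff φ hinj).1 h1
    have h3 := congrArg QuadraticAlgebra.re h2
    have h4 := congrArg QuadraticAlgebra.im h2
    simp at h3 h4
    exact QuadraticAlgebra.ext h3 h4
  · obtain ⟨x, hx⟩ := hsurj (y : K)
    have hxi : IsIntegral ℤ x := by
      rw [← isIntegral_algHom_iff (φ : QuadraticAlgebra ℚ (-4) 1 →+* K).toIntAlgHom hinj]
      change IsIntegral ℤ (φ x)
      rw [hx]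
      exact y.isIntegral_coe
    obtain ⟨a, b, ha, hb⟩ := QO.exists_int_of_isIntegral hxi
    refine ⟨⟨a, b⟩, RingOfIntegers.ext ?_⟩
    rw [← hx, hφ, ha, hb]
    simp only [QO.evalHom_apply, map_add, map_mul, map_intCast, hτt, Rat.cast_intCast]

end RingOfIntegers

namespace QO

section Ring

variable {R : Type*} [CommRing R] (e : QO ≃+* R)

lemma exists_heightOneSpectrum_comap {J : Ideal QO} (hJ : J.IsPrime) (hJ0 : J ≠ ⊥) :
    ∃ v : HeightOneSpectrum R, J = v.asIdeal.comap e := by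
  refine ⟨⟨J.comap e.symm, Ideal.comap_isPrime _ _, fun h => hJ0 ?_⟩, ?_⟩
  · refine (Submodule.eq_bot_iff _).2 fun x hx => ?_
    have : e x ∈ J.comap e.symm := by simpa [Ideal.mem_comap] using hx
    rw [h] at this
    simpa using this
  · ext x
    simp [Ideal.mem_comap]

lemma comap_ne_bot (v : HeightOneSpectrum R) : v.asIdeal.comap e ≠ ⊥ := by
  intro h
  refine v.ne_bot ((Submodule.eq_bot_iff _).2 fun x hx => ?_)
  have : e.symm x ∈ v.asIdeal.comap e := by rwa [Ideal.mem_comap, e.apply_symm_apply]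
  rw [h] at this
  simpa using this

lemma three_mem_comap {q : HeightOneSpectrum R} (h3 : Ideal.span {(3 : R)} = q.asIdeal ^ 2) :
    ((3 : ℕ) : QO) ∈ q.asIdeal.comap e ∧ w - ((-1 : ℤ) : QO) ∈ q.asIdeal.comap e := by
  have h : (3 : QO) ∈ q.asIdeal.comap e := by
    rw [Ideal.mem_comap, map_ofNat]
    exact Ideal.pow_le_self two_ne_zero (h3 ▸ Ideal.mem_span_singleton_self _)
  refine ⟨by exact_mod_cast h, ?_⟩
  refine (Ideal.comap_isPrime e q.asIdeal).mem_of_pow_mem 2 ?_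
  have : (w - ((-1 : ℤ) : QO)) ^ 2 = (w - 1) * 3 := by decide +kernel
  rw [this]
  exact Ideal.mul_mem_left _ _ h

variable [IsDedekindDomain R]

lemma eq_of_comap_le {u v : HeightOneSpectrum R}
    (h : u.asIdeal.comap e ≤ v.asIdeal.comap e) : u = v := by
  refine HeightOneSpectrum.eq_of_asIdeal_le fun x hx => ?_
  have : e.symm x ∈ v.asIdeal.comap e := h (by rwa [Ideal.mem_comap, e.apply_symm_apply])
  rwa [Ideal.mem_comap, e.apply_symm_apply] at this

/-- The primes of `ℤ[ω]` corresponding to a set of primes of `R`. -/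
abbrev comapSet (S : Set (HeightOneSpectrum R)) : Set (Ideal QO) :=
  (fun v => v.asIdeal.comap e) '' S

lemma hasPrimeOver_comapSet_iff {S : Set (HeightOneSpectrum R)} {r : ℕ} (hr : r.Prime) {t : ℤ}
    {v : HeightOneSpectrum R} (hv : (r : QO) ∈ v.asIdeal.comap e)
    (hvt : w - t ∈ v.asIdeal.comap e) :
    HasPrimeOver (comapSet e S) r t ↔ v ∈ S := by
  constructor
  · rintro ⟨_, ⟨u, hu, rfl⟩, hru, htu⟩
    rwa [← eq_of_comap_le e (le_of_mem_of_mem (Ideal.comap_isPrime _ _) (comap_ne_bot e u) hr hru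
      htu hv hvt)]
  · exact fun h => ⟨_, ⟨v, h, rfl⟩, hv, hvt⟩

variable {K : Type*} [Field K] [Algebra R K] [IsFractionRing R K]
  {S : Finset (HeightOneSpectrum R)} {P : QO}

lemma isUnit_algebraMap_integer {x : QO} (hx : x ≠ 0)
    (h : ∀ v : HeightOneSpectrum R, e x ∈ v.asIdeal → v ∈ S) :
    IsUnit ((algebraMap R ((S : Set (HeightOneSpectrum R)).integer K)).comp (e : QO →+* R) x) :=
  Set.isUnit_algebraMap_integer ((map_ne_zero_iff e e.injective).2 hx) h

lemma isPrimeSupport_integer (hS : S.Nonempty)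
    (hP0 : P ≠ 0) (hP : ∀ v : HeightOneSpectrum R, e P ∈ v.asIdeal ↔ v ∈ S) :
    IsPrimeSupport ((algebraMap R ((S : Set (HeightOneSpectrum R)).integer K)).comp (e : QO →+* R))
      P (comapSet e S) where
  nonempty := Set.Nonempty.image _ hS
  isPrime := by
    rintro _ ⟨v, -, rfl⟩
    exact Ideal.comap_isPrime _ _
  ne_bot := by
    rintro _ ⟨v, -, rfl⟩
    exact comap_ne_bot e v
  mem_of_mem J hJ hPJ := by
    obtain ⟨v, rfl⟩ := exists_heightOneSpectrum_comap e hJ (by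
      rintro rfl
      exact hP0 hPJ)
    exact ⟨v, (hP v).1 hPJ, rfl⟩
  isUnit x hx h := by
    refine isUnit_algebraMap_integer e hx fun v hv => ?_
    obtain ⟨_, ⟨u, hu, rfl⟩, huv⟩ := h _ (Ideal.comap_isPrime e v.asIdeal) hv
    rwa [← eq_of_comap_le e huv]

lemma isSLocalization_integer [Finite (ClassGroup R)] (hS : S.Nonempty)
    (hP0 : P ≠ 0) (hP : ∀ v : HeightOneSpectrum R, e P ∈ v.asIdeal ↔ v ∈ S) :
    IsSLocalization ((algebraMap R ((S : Set (HeightOneSpectrum R)).integer K)).comp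
      (e : QO →+* R)) P where
  inj := by
    intro x y hxy
    apply e.injective
    apply IsFractionRing.injective R K
    exact congrArg Subtype.val hxy
  isUnit := isUnit_algebraMap_integer e hP0 fun v hv => (hP v).1 hv
  pow_ne_one n hn h := by
    obtain ⟨v, hv⟩ := hS
    apply v.isPrime.ne_top
    rw [Ideal.eq_top_iff_one, ← map_one e, ← h, map_pow]
    exact Ideal.pow_mem_of_mem _ ((hP v).2 hv) n (Nat.pos_of_ne_zero hn)
  exists_mul_eq a := by
    obtain ⟨k, x, hx⟩ := Finset.exists_pow_mul_eq_algebraMap (fun v hv => (hP v).2 hv) a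
    exact ⟨k, e.symm x, by simpa using hx⟩
  exists_pow_eq d hd := by
    obtain ⟨h, δ, g, hδ0, hδ, hdg, hg⟩ := exists_pow_eq_mul_of_finset S S subset_rfl (e d)
      ((map_ne_zero_iff e e.injective).2 hd)
    refine ⟨h, e.symm δ, e.symm g,
      isUnit_algebraMap_integer e ((map_ne_zero_iff _ e.symm.injective).2 hδ0)
        (fun v hv => hδ v (by simpa using hv)), ?_, ?_⟩
    · rw [← map_mul, ← hdg, map_pow, e.symm_apply_apply]
    · rw [← Ideal.isCoprime_span_singleton_iff, Ideal.isCoprime_iff_sup_eq]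
      by_contra hne
      obtain ⟨M, hM, hle⟩ := Ideal.exists_le_maximal _ hne
      rw [sup_le_iff, Ideal.span_singleton_le_iff_mem, Ideal.span_singleton_le_iff_mem] at hle
      obtain ⟨v, rfl⟩ := exists_heightOneSpectrum_comap e hM.isPrime (by
        rintro rfl
        exact hP0 hle.2)
      exact hg v ((hP v).1 hle.2) (by simpa only [Ideal.mem_comap, e.apply_symm_apply] using hle.1)

/-- The two primes above `2` are `(2, ω)` and `(2, ω - 1)` in some order. -/
lemma two_mem_comap {p₁ p₂ : HeightOneSpectrum R} (hp : p₁ ≠ p₂)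
    (h2 : Ideal.span {(2 : R)} = p₁.asIdeal * p₂.asIdeal) :
    ((2 : ℕ) : QO) ∈ p₁.asIdeal.comap e ∧ ((2 : ℕ) : QO) ∈ p₂.asIdeal.comap e ∧
      ((w - ((0 : ℤ) : QO) ∈ p₁.asIdeal.comap e ∧ w - ((1 : ℤ) : QO) ∈ p₂.asIdeal.comap e) ∨
        (w - ((1 : ℤ) : QO) ∈ p₁.asIdeal.comap e ∧ w - ((0 : ℤ) : QO) ∈ p₂.asIdeal.comap e)) := by
  have hmem : (2 : R) ∈ p₁.asIdeal * p₂.asIdeal := h2 ▸ Ideal.mem_span_singleton_self _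
  have key : ∀ p : HeightOneSpectrum R, (2 : R) ∈ p.asIdeal →
      ((2 : ℕ) : QO) ∈ p.asIdeal.comap e ∧ (w - ((0 : ℤ) : QO) ∈ p.asIdeal.comap e ∨
        w - ((1 : ℤ) : QO) ∈ p.asIdeal.comap e) := by
    intro p hp
    have h : (2 : QO) ∈ p.asIdeal.comap e := by rwa [Ideal.mem_comap, map_ofNat]
    refine ⟨by exact_mod_cast h, (Ideal.comap_isPrime e p.asIdeal).mem_or_mem ?_⟩
    have : (w - ((0 : ℤ) : QO)) * (w - ((1 : ℤ) : QO)) = (-2) * 2 := by decide +kernel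
    rw [this]
    exact Ideal.mul_mem_left _ _ h
  obtain ⟨h1, h1'⟩ := key p₁ (Ideal.mul_le_left hmem)
  obtain ⟨h2, h2'⟩ := key p₂ (Ideal.mul_le_right hmem)
  have hne : ∀ t : ℤ, w - (t : QO) ∈ p₁.asIdeal.comap e → w - (t : QO) ∉ p₂.asIdeal.comap e :=
    fun t ht ht' => hp (eq_of_comap_le e (le_of_mem_of_mem (Ideal.comap_isPrime _ _)
      (comap_ne_bot e p₁) Nat.prime_two h1 ht h2 ht'))
  refine ⟨h1, h2, ?_⟩
  rcases h1' with h | h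
  · exact .inl ⟨h, h2'.resolve_left (hne 0 h)⟩
  · exact .inr ⟨h, h2'.resolve_right (hne 1 h)⟩

end Ring

end QO

lemma card_subtype_fin_two (p : Fin 2 → Prop) [DecidablePred p] :
    Nat.card {i // p i} = (if p 0 then 1 else 0) + (if p 1 then 1 else 0) := by
  rw [Nat.card_eq_fintype_card, Fintype.card_subtype, Finset.card_filter, Fin.sum_univ_two]

lemma card_subtype_unit (p : Unit → Prop) [DecidablePred p] :
    Nat.card {i // p i} = if p () then 1 else 0 := by
  rw [Nat.card_eq_fintype_card, Fintype.card_subtype, Finset.card_filter,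
    Finset.univ_unique, Finset.sum_singleton]

/-- for the ring of integers `O_{−15}` of `ℚ(√−15)`, where
`2 O_{−15} = p₁ p₂` (split) and `3 O_{−15} = q²` (ramified), and any nonempty finite set
`S` of nonzero primes, `SL₂(O_{−15,S})ᵃᵇ ≅ (ℤ/4)^{β_{p₁}+β_{p₂}} ⊕ (ℤ/3)^{β_q}`. -/
theorem sl2_abelianization_O_neg_fifteen_S
    (K : Type*) [Field K] [NumberField K]
    (hdeg : Module.finrank ℚ K = 2)
    (α : K) (hα : α ^ 2 = -15)
    (p₁ p₂ q : HeightOneSpectrum (𝓞 K)) (hp : p₁ ≠ p₂)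
    (h2 : Ideal.span {(2 : 𝓞 K)} = p₁.asIdeal * p₂.asIdeal)
    (h3 : Ideal.span {(3 : 𝓞 K)} = q.asIdeal ^ 2)
    (S : Finset (HeightOneSpectrum (𝓞 K))) (hS : S.Nonempty)
    (A : Subalgebra (𝓞 K) K)
    (hA : A = (S : Set (HeightOneSpectrum (𝓞 K))).integer K) :
    Nonempty (SL2ab ↥A ≃+
      ((Fin (beta S p₁ + beta S p₂) → ZMod 4) × (Fin (beta S q) → ZMod 3))) := by
  classical
  subst hA
  obtain ⟨e⟩ := QO.nonempty_ringEquiv hdeg hα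
  obtain ⟨P, hP0, hP⟩ := exists_mem_iff_mem_finset S
  obtain ⟨P, rfl⟩ := e.surjective P
  rw [map_ne_zero_iff e e.injective] at hP0
  obtain ⟨φ⟩ := (QO.isPrimeSupport_integer (K := K) e hS hP0 hP).nonempty_addEquiv
    (QO.isSLocalization_integer e hS hP0 hP)
  obtain ⟨hq, hq'⟩ := QO.three_mem_comap e h3
  obtain ⟨hp1, hp2, hpw⟩ := QO.two_mem_comap e hp h2
  have c3 : Nat.card {_j : Unit // ¬ QO.HasPrimeOver (QO.comapSet e S) 3 (-1)} = beta S q := by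
    rw [card_subtype_unit, QO.hasPrimeOver_comapSet_iff e Nat.prime_three hq hq', beta]
    simp [ite_not]
  have c2 : Nat.card {i : Fin 2 // ¬ QO.HasPrimeOver (QO.comapSet e S) 2 (i : ℕ)} =
      beta S p₁ + beta S p₂ := by
    rw [card_subtype_fin_two]
    rcases hpw with ⟨h, h'⟩ | ⟨h, h'⟩
    · have a := QO.hasPrimeOver_comapSet_iff (S := S) e Nat.prime_two hp1 h
      have b := QO.hasPrimeOver_comapSet_iff (S := S) e Nat.prime_two hp2 h'
      simp only [beta, Finset.mem_coe] at a b ⊢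
      simp [a, b, -not_exists, -not_and]
    · have a := QO.hasPrimeOver_comapSet_iff (S := S) e Nat.prime_two hp1 h
      have b := QO.hasPrimeOver_comapSet_iff (S := S) e Nat.prime_two hp2 h'
      simp only [beta, Finset.mem_coe] at a b ⊢
      simp [a, b, -not_exists, -not_and, add_comm]
  exact ⟨φ.trans (AddEquiv.prodCongr
    (LinearEquiv.funCongrLeft ℤ _ (Finite.equivFinOfCardEq c2).symm).toAddEquiv
    (LinearEquiv.funCongrLeft ℤ _ (Finite.equivFinOfCardEq c3).symm).toAddEquiv)⟩
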